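/- arXiv:2105.00760 — 2 statements merged into one kernel-verified Lean document; each statement's English description precedes it below -/
import Mathlib

section
/- Strong duality for uncertainty quantification under a primal-side Slater condition: under assumptions (G), (C), (H) and (S), if (AP-W') admits a Slater point and the support set S is bounded, then the problems (AP-W'), (AP-W), (D-UQ), (P-UQ), (FR), (AD-B) and (AD-B') all have the same optimal value and (AD-B') is solvable; moreover, if (τ*, λ*, {ω_i*, υ_i*}) solves (AD-B'), then the discrete distribution that assigns probability λ_i* to the point υ_i*/λ_i* for every i with λ_i* > 0 solves (P-UQ). -/
noncomputable section
open scoped BigOperators Classical ENNReal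
open MeasureTheory

/-- Dot product on `ℝ^n`. -/
def dotp {n : ℕ} (x y : Fin n → ℝ) : ℝ := ∑ i, x i * y i

/-- The (effective) domain of an extended-real-valued function. -/
def edom {n : ℕ} (f : (Fin n → ℝ) → EReal) : Set (Fin n → ℝ) := {x | f x < ⊤}

/-- `f` is proper: it never takes the value `−∞` and is `< +∞` somewhere. -/
def ProperFn {n : ℕ} (f : (Fin n → ℝ) → EReal) : Prop := (∀ x, f x ≠ ⊥) ∧ (∃ x, f x ≠ ⊤)

/-- `f` is closed: lower semicontinuous, and either nowhere `−∞` or identically `−∞`. -/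
def ClosedFn {n : ℕ} (f : (Fin n → ℝ) → EReal) : Prop :=
  LowerSemicontinuous f ∧ ((∀ x, f x ≠ ⊥) ∨ (∀ x, f x = ⊥))

/-- Convexity of an extended-real-valued function, via convexity of its epigraph. -/
def ConvexFn {n : ℕ} (f : (Fin n → ℝ) → EReal) : Prop :=
  Convex ℝ {p : (Fin n → ℝ) × ℝ | f p.1 ≤ (p.2 : EReal)}

/-- The conjugate `f*(w) = sup_x { wᵀx − f(x) }`. -/
def conjFn {n : ℕ} (f : (Fin n → ℝ) → EReal) (w : Fin n → ℝ) : EReal :=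
  ⨆ x : Fin n → ℝ, (((dotp w x : ℝ) : EReal) - f x)

/-- The support function `δ*_X(w) = sup_{x ∈ X} xᵀw`. -/
def suppFn {n : ℕ} (X : Set (Fin n → ℝ)) (w : Fin n → ℝ) : EReal :=
  ⨆ x ∈ X, ((dotp x w : ℝ) : EReal)

/-- The convex perspective `t f(x/t)` of a proper closed convex function `f`,
equal to `t f(x/t)` for `t > 0` and to `δ*_{dom f*}(x)` for `t = 0`. -/
def persp {n : ℕ} (f : (Fin n → ℝ) → EReal) (x : Fin n → ℝ) (t : ℝ) : EReal :=
  if 0 < t then (t : EReal) * f (t⁻¹ • x) else suppFn (edom (conjFn f)) x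

/-- The concave perspective `t g(x/t)` of a function `g` with `−g` proper, closed and
convex, equal to `t g(x/t)` for `t > 0` and to `−δ*_{dom (−g)*}(x)` for `t = 0`. -/
def cpersp {n : ℕ} (g : (Fin n → ℝ) → EReal) (x : Fin n → ℝ) (t : ℝ) : EReal :=
  if 0 < t then (t : EReal) * g (t⁻¹ • x)
  else - suppFn (edom (conjFn (fun z => - g z))) x

/-- `f` is an affine ("linear") constraint function. -/
def IsAffineFn {n : ℕ} (f : (Fin n → ℝ) → EReal) : Prop :=
  ∃ (a : Fin n → ℝ) (b : ℝ), ∀ x, f x = ((dotp a x + b : ℝ) : EReal)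

/-- Positive part of an extended real number, as an extended non-negative real. -/
def epos (x : EReal) : ℝ≥0∞ := if x = ⊤ then ⊤ else ENNReal.ofReal x.toReal

/-- Expectation `E_P[f(z̃)]` with the convention that it equals `−∞` whenever the
expectations of the positive and negative parts of `f(z̃)` are both infinite
(infeasibility dominates in maximization). -/
def lowExp {n : ℕ} (P : Measure (Fin n → ℝ)) (f : (Fin n → ℝ) → EReal) : EReal :=
  ((∫⁻ z, epos (f z) ∂P : ℝ≥0∞) : EReal) - ((∫⁻ z, epos (-(f z)) ∂P : ℝ≥0∞) : EReal)

/-- Expectation `E_P[f(z̃)]` with the convention that it equals `+∞` whenever the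
expectations of the positive and negative parts of `f(z̃)` are both infinite
(infeasibility dominates in the moment constraints). -/
def highExp {n : ℕ} (P : Measure (Fin n → ℝ)) (f : (Fin n → ℝ) → EReal) : EReal :=
  - lowExp P (fun z => - f z)

variable {dz I J L : ℕ}

/-- Assumption (G): `−g_i` is proper, closed and convex for each `i`. -/
def AssumptionG (gi : Fin I → (Fin dz → ℝ) → EReal) : Prop :=
  ∀ i, ProperFn (fun z => - gi i z) ∧ ClosedFn (fun z => - gi i z) ∧
    ConvexFn (fun z => - gi i z)

/-- Assumption (C): each `c_ℓ` is proper, closed and convex. -/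
def AssumptionC (c : Fin L → (Fin dz → ℝ) → EReal) : Prop :=
  ∀ ℓ, ProperFn (c ℓ) ∧ ClosedFn (c ℓ) ∧ ConvexFn (c ℓ)

/-- Assumption (H): each `h_j` is proper, closed and convex. -/
def AssumptionH (h : Fin J → (Fin dz → ℝ) → EReal) : Prop :=
  ∀ j, ProperFn (h j) ∧ ClosedFn (h j) ∧ ConvexFn (h j)

/-- The support set `S = {z : c_ℓ(z) ≤ 0 ∀ℓ}`. -/
def Sset (c : Fin L → (Fin dz → ℝ) → EReal) : Set (Fin dz → ℝ) :=
  {z | ∀ ℓ, c ℓ z ≤ 0}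

/-- The set `S̄_i = {z ∈ S : z ∈ dom h_j ∀j, z ∈ dom(−g_i)}`. -/
def SbarI (gi : Fin I → (Fin dz → ℝ) → EReal) (c : Fin L → (Fin dz → ℝ) → EReal)
    (h : Fin J → (Fin dz → ℝ) → EReal) (i : Fin I) : Set (Fin dz → ℝ) :=
  {z | z ∈ Sset c ∧ (∀ j, h j z < ⊤) ∧ ⊥ < gi i z}

/-- The effective support set `S̄ = ∪_i S̄_i`. -/
def Sbar (gi : Fin I → (Fin dz → ℝ) → EReal) (c : Fin L → (Fin dz → ℝ) → EReal)
    (h : Fin J → (Fin dz → ℝ) → EReal) : Set (Fin dz → ℝ) :=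
  ⋃ i, SbarI gi c h i

/-- Assumption (S): each `S̄_i` is nonempty. -/
def AssumptionS (gi : Fin I → (Fin dz → ℝ) → EReal)
    (c : Fin L → (Fin dz → ℝ) → EReal) (h : Fin J → (Fin dz → ℝ) → EReal) : Prop :=
  ∀ i, (SbarI gi c h i).Nonempty

/-- The disutility function `g(z) = max_i g_i(z)`. -/
def gFun (gi : Fin I → (Fin dz → ℝ) → EReal) (z : Fin dz → ℝ) : EReal :=
  ⨆ i, gi i z

/-- The ambiguity set `𝒫` of all probability distributions supported on `S`
satisfying the moment conditions `E_P[h_j(z̃)] ≤ μ_j`. -/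
def ambSet (c : Fin L → (Fin dz → ℝ) → EReal) (h : Fin J → (Fin dz → ℝ) → EReal)
    (μ : Fin J → ℝ) : Set (Measure (Fin dz → ℝ)) :=
  {P | IsProbabilityMeasure P ∧ P (Sset c) = 1 ∧
       ∀ j, highExp P (h j) ≤ ((μ j : ℝ) : EReal)}

/-- Optimal value of the primal uncertainty quantification problem (P-UQ). -/
def puqVal (gi : Fin I → (Fin dz → ℝ) → EReal) (c : Fin L → (Fin dz → ℝ) → EReal)
    (h : Fin J → (Fin dz → ℝ) → EReal) (μ : Fin J → ℝ) : EReal :=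
  ⨆ P ∈ {P | P ∈ ambSet c h μ ∧ lowExp P (gFun gi) ≠ ⊥}, lowExp P (gFun gi)

/-- Feasible region of the dual uncertainty quantification problem (D-UQ). -/
def duqFeas (gi : Fin I → (Fin dz → ℝ) → EReal) (c : Fin L → (Fin dz → ℝ) → EReal)
    (h : Fin J → (Fin dz → ℝ) → EReal) : Set (ℝ × (Fin J → ℝ)) :=
  {p | (∀ j, 0 ≤ p.2 j) ∧
       ∀ z ∈ Sbar gi c h, gFun gi z ≤ (p.1 : EReal) + ∑ j, (p.2 j : EReal) * h j z}

/-- Optimal value of the dual uncertainty quantification problem (D-UQ). -/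
def duqVal (gi : Fin I → (Fin dz → ℝ) → EReal) (c : Fin L → (Fin dz → ℝ) → EReal)
    (h : Fin J → (Fin dz → ℝ) → EReal) (μ : Fin J → ℝ) : EReal :=
  ⨅ p ∈ duqFeas gi c h, ((p.1 + dotp μ p.2 : ℝ) : EReal)

/-- (D-UQ) is solvable. -/
def duqSolvable (gi : Fin I → (Fin dz → ℝ) → EReal) (c : Fin L → (Fin dz → ℝ) → EReal)
    (h : Fin J → (Fin dz → ℝ) → EReal) (μ : Fin J → ℝ) : Prop :=
  duqFeas gi c h = ∅ ∨
    ∃ p ∈ duqFeas gi c h, ((p.1 + dotp μ p.2 : ℝ) : EReal) = duqVal gi c h μ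

/-- The augmented support set
`U_i = {(z,u,t) : c_ℓ(z) ≤ 0 ∀ℓ, h(z) ≤ u, g_i(z) ≥ t}`. -/
def Uset {dz I J L : ℕ} (gi : Fin I → (Fin dz → ℝ) → EReal)
    (c : Fin L → (Fin dz → ℝ) → EReal) (h : Fin J → (Fin dz → ℝ) → EReal)
    (i : Fin I) : Set ((Fin dz → ℝ) × (Fin J → ℝ) × ℝ) :=
  {q | (∀ ℓ, c ℓ q.1 ≤ 0) ∧ (∀ j, h j q.1 ≤ ((q.2.1 j : ℝ) : EReal)) ∧
       ((q.2.2 : ℝ) : EReal) ≤ gi i q.1}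

/-- Feasible region of the ambiguous primal worst problem (AP-W): `β ≥ 0` and
`sup_{(z,u,t) ∈ U_i} { t − α − uᵀβ } ≤ 0` for every `i`. -/
def apwFeas {dz I J L : ℕ} (gi : Fin I → (Fin dz → ℝ) → EReal)
    (c : Fin L → (Fin dz → ℝ) → EReal) (h : Fin J → (Fin dz → ℝ) → EReal) :
    Set (ℝ × (Fin J → ℝ)) :=
  {p | (∀ j, 0 ≤ p.2 j) ∧
       ∀ i, ∀ q ∈ Uset gi c h i, q.2.2 - p.1 - dotp q.2.1 p.2 ≤ 0}

/-- Optimal value of the ambiguous primal worst problem (AP-W). -/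
def apwVal {dz I J L : ℕ} (gi : Fin I → (Fin dz → ℝ) → EReal)
    (c : Fin L → (Fin dz → ℝ) → EReal) (h : Fin J → (Fin dz → ℝ) → EReal)
    (μ : Fin J → ℝ) : EReal :=
  ⨅ p ∈ apwFeas gi c h, ((p.1 + dotp μ p.2 : ℝ) : EReal)

/-- (AP-W) is solvable. -/
def apwSolvable {dz I J L : ℕ} (gi : Fin I → (Fin dz → ℝ) → EReal)
    (c : Fin L → (Fin dz → ℝ) → EReal) (h : Fin J → (Fin dz → ℝ) → EReal)
    (μ : Fin J → ℝ) : Prop :=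
  apwFeas gi c h = ∅ ∨
    ∃ p ∈ apwFeas gi c h, ((p.1 + dotp μ p.2 : ℝ) : EReal) = apwVal gi c h μ

/-- Objective of the finite reduction problem (FR): `Σ_i λ_i g(z_i)`. -/
def frObj {dz I : ℕ} (gi : Fin I → (Fin dz → ℝ) → EReal)
    (p : (Fin I → Fin dz → ℝ) × (Fin I → ℝ)) : EReal :=
  ∑ i, ((p.2 i : ℝ) : EReal) * gFun gi (p.1 i)

/-- Feasible region of the finite reduction problem (FR). -/
def frFeas {dz I J L : ℕ} (gi : Fin I → (Fin dz → ℝ) → EReal)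
    (c : Fin L → (Fin dz → ℝ) → EReal) (h : Fin J → (Fin dz → ℝ) → EReal)
    (μ : Fin J → ℝ) : Set ((Fin I → Fin dz → ℝ) × (Fin I → ℝ)) :=
  {p | (∀ i, p.1 i ∈ Sbar gi c h) ∧ (∀ i, 0 ≤ p.2 i) ∧ (∑ i, p.2 i) = 1 ∧
       (∀ j, (∑ i, ((p.2 i : ℝ) : EReal) * h j (p.1 i)) ≤ ((μ j : ℝ) : EReal)) ∧
       frObj gi p ≠ ⊥}

/-- Optimal value of the finite reduction problem (FR). -/
def frVal {dz I J L : ℕ} (gi : Fin I → (Fin dz → ℝ) → EReal)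
    (c : Fin L → (Fin dz → ℝ) → EReal) (h : Fin J → (Fin dz → ℝ) → EReal)
    (μ : Fin J → ℝ) : EReal :=
  ⨆ p ∈ frFeas gi c h μ, frObj gi p

/-- (FR) is solvable. -/
def frSolvable {dz I J L : ℕ} (gi : Fin I → (Fin dz → ℝ) → EReal)
    (c : Fin L → (Fin dz → ℝ) → EReal) (h : Fin J → (Fin dz → ℝ) → EReal)
    (μ : Fin J → ℝ) : Prop :=
  frFeas gi c h μ = ∅ ∨ ∃ p ∈ frFeas gi c h μ, frObj gi p = frVal gi c h μ

/-- Feasible region of the ambiguous dual best problem (AD-B). -/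
def adbFeas {dz I J L : ℕ} (gi : Fin I → (Fin dz → ℝ) → EReal)
    (c : Fin L → (Fin dz → ℝ) → EReal) (h : Fin J → (Fin dz → ℝ) → EReal)
    (μ : Fin J → ℝ) :
    Set ((Fin I → (Fin dz → ℝ) × (Fin J → ℝ) × ℝ) × (Fin I → ℝ)) :=
  {p | (∀ i, p.1 i ∈ Uset gi c h i) ∧ (∀ i, 0 ≤ p.2 i) ∧ (∑ i, p.2 i) = 1 ∧
       (∀ j, (∑ i, p.2 i * (p.1 i).2.1 j) ≤ μ j)}

/-- Optimal value of the ambiguous dual best problem (AD-B). -/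
def adbVal {dz I J L : ℕ} (gi : Fin I → (Fin dz → ℝ) → EReal)
    (c : Fin L → (Fin dz → ℝ) → EReal) (h : Fin J → (Fin dz → ℝ) → EReal)
    (μ : Fin J → ℝ) : EReal :=
  ⨆ p ∈ adbFeas gi c h μ, (((∑ i, p.2 i * (p.1 i).2.2 : ℝ)) : EReal)

/-- (AD-B) is solvable. -/
def adbSolvable {dz I J L : ℕ} (gi : Fin I → (Fin dz → ℝ) → EReal)
    (c : Fin L → (Fin dz → ℝ) → EReal) (h : Fin J → (Fin dz → ℝ) → EReal)
    (μ : Fin J → ℝ) : Prop :=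
  adbFeas gi c h μ = ∅ ∨
    ∃ p ∈ adbFeas gi c h μ,
      (((∑ i, p.2 i * (p.1 i).2.2 : ℝ)) : EReal) = adbVal gi c h μ

/-- Affine ("linear") extended-real-valued function on a general normed space. -/
def IsAffineCLM {E : Type*} [NormedAddCommGroup E] [NormedSpace ℝ E]
    (g : E → EReal) : Prop :=
  ∃ (a : E →L[ℝ] ℝ) (b : ℝ), ∀ p, g p = ((a p + b : ℝ) : EReal)

/-- `i`-th constraint function of the reformulated ambiguous primal worst problem
(AP-W'): `(−g_i)*(y_i⁽⁰⁾) + Σ_j β_j h_j*(y_{ij}⁽¹⁾/β_j) + Σ_ℓ ν_{iℓ} c_ℓ*(y_{iℓ}⁽²⁾/ν_{iℓ}) − α`. -/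
def apwpCon {dz I J L : ℕ} (gi : Fin I → (Fin dz → ℝ) → EReal)
    (c : Fin L → (Fin dz → ℝ) → EReal) (h : Fin J → (Fin dz → ℝ) → EReal) (i : Fin I)
    (q : ℝ × (Fin J → ℝ) × (Fin I → Fin dz → ℝ) × (Fin I → Fin J → Fin dz → ℝ) ×
         (Fin I → Fin L → Fin dz → ℝ) × (Fin I → Fin L → ℝ)) : EReal :=
  conjFn (fun z => - gi i z) (q.2.2.1 i)
    + ∑ j, persp (conjFn (h j)) (q.2.2.2.1 i j) (q.2.1 j)
    + ∑ ℓ, persp (conjFn (c ℓ)) (q.2.2.2.2.1 i ℓ) (q.2.2.2.2.2 i ℓ)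
    - ((q.1 : ℝ) : EReal)

/-- Feasible region of (AP-W'). -/
def apwpFeas {dz I J L : ℕ} (gi : Fin I → (Fin dz → ℝ) → EReal)
    (c : Fin L → (Fin dz → ℝ) → EReal) (h : Fin J → (Fin dz → ℝ) → EReal) :
    Set (ℝ × (Fin J → ℝ) × (Fin I → Fin dz → ℝ) × (Fin I → Fin J → Fin dz → ℝ) ×
         (Fin I → Fin L → Fin dz → ℝ) × (Fin I → Fin L → ℝ)) :=
  {q | (∀ i, apwpCon gi c h i q ≤ 0) ∧
       (∀ i, (q.2.2.1 i + ∑ j, q.2.2.2.1 i j + ∑ ℓ, q.2.2.2.2.1 i ℓ) = 0) ∧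
       (∀ j, 0 ≤ q.2.1 j) ∧ (∀ i ℓ, 0 ≤ q.2.2.2.2.2 i ℓ)}

/-- Optimal value of (AP-W'). -/
def apwpVal {dz I J L : ℕ} (gi : Fin I → (Fin dz → ℝ) → EReal)
    (c : Fin L → (Fin dz → ℝ) → EReal) (h : Fin J → (Fin dz → ℝ) → EReal)
    (μ : Fin J → ℝ) : EReal :=
  ⨅ q ∈ apwpFeas gi c h, ((q.1 + dotp μ q.2.1 : ℝ) : EReal)

/-- (AP-W') is solvable. -/
def apwpSolvable {dz I J L : ℕ} (gi : Fin I → (Fin dz → ℝ) → EReal)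
    (c : Fin L → (Fin dz → ℝ) → EReal) (h : Fin J → (Fin dz → ℝ) → EReal)
    (μ : Fin J → ℝ) : Prop :=
  apwpFeas gi c h = ∅ ∨
    ∃ q ∈ apwpFeas gi c h, ((q.1 + dotp μ q.2.1 : ℝ) : EReal) = apwpVal gi c h μ

/-- Slater point of (AP-W') (whose further explicit constraints are affine equalities
and the linear inequalities `β ≥ 0`, `ν ≥ 0`). -/
def SlaterAPWP {dz I J L : ℕ} (gi : Fin I → (Fin dz → ℝ) → EReal)
    (c : Fin L → (Fin dz → ℝ) → EReal) (h : Fin J → (Fin dz → ℝ) → EReal)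
    (q : ℝ × (Fin J → ℝ) × (Fin I → Fin dz → ℝ) × (Fin I → Fin J → Fin dz → ℝ) ×
         (Fin I → Fin L → Fin dz → ℝ) × (Fin I → Fin L → ℝ)) : Prop :=
  (∀ i, q ∈ intrinsicInterior ℝ {r | apwpCon gi c h i r < ⊤}) ∧
  q ∈ apwpFeas gi c h ∧
  (∀ i, ¬ IsAffineCLM (apwpCon gi c h i) → apwpCon gi c h i q < 0)

/-- Strict Slater point of (AP-W'): all inequality constraints hold strictly. -/
def StrictSlaterAPWP {dz I J L : ℕ} (gi : Fin I → (Fin dz → ℝ) → EReal)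
    (c : Fin L → (Fin dz → ℝ) → EReal) (h : Fin J → (Fin dz → ℝ) → EReal)
    (q : ℝ × (Fin J → ℝ) × (Fin I → Fin dz → ℝ) × (Fin I → Fin J → Fin dz → ℝ) ×
         (Fin I → Fin L → Fin dz → ℝ) × (Fin I → Fin L → ℝ)) : Prop :=
  (∀ i, q ∈ intrinsicInterior ℝ {r | apwpCon gi c h i r < ⊤}) ∧
  (∀ i, (q.2.2.1 i + ∑ j, q.2.2.2.1 i j + ∑ ℓ, q.2.2.2.2.1 i ℓ) = 0) ∧
  (∀ i, apwpCon gi c h i q < 0) ∧ (∀ j, 0 < q.2.1 j) ∧ (∀ i ℓ, 0 < q.2.2.2.2.2 i ℓ)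

/-- Constraint function `λ_i c_ℓ(υ_i/λ_i)` of the reformulated ambiguous dual best
problem (AD-B'). -/
def adbpConC {dz I J L : ℕ} (c : Fin L → (Fin dz → ℝ) → EReal) (i : Fin I) (ℓ : Fin L)
    (r : (Fin I → ℝ) × (Fin I → ℝ) × (Fin I → Fin J → ℝ) × (Fin I → Fin dz → ℝ)) :
    EReal :=
  persp (c ℓ) (r.2.2.2 i) (r.2.1 i)

/-- Constraint function `λ_i h_j(υ_i/λ_i) − ω_{ij}` of (AD-B'). -/
def adbpConH {dz I J L : ℕ} (h : Fin J → (Fin dz → ℝ) → EReal) (i : Fin I) (j : Fin J)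
    (r : (Fin I → ℝ) × (Fin I → ℝ) × (Fin I → Fin J → ℝ) × (Fin I → Fin dz → ℝ)) :
    EReal :=
  persp (h j) (r.2.2.2 i) (r.2.1 i) - ((r.2.2.1 i j : ℝ) : EReal)

/-- Constraint function `τ_i − λ_i g_i(υ_i/λ_i)` of (AD-B') (concave perspective). -/
def adbpConG {dz I J L : ℕ} (gi : Fin I → (Fin dz → ℝ) → EReal) (i : Fin I)
    (r : (Fin I → ℝ) × (Fin I → ℝ) × (Fin I → Fin J → ℝ) × (Fin I → Fin dz → ℝ)) :
    EReal :=
  ((r.1 i : ℝ) : EReal) - cpersp (gi i) (r.2.2.2 i) (r.2.1 i)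

/-- Feasible region of (AD-B'). -/
def adbpFeas {dz I J L : ℕ} (gi : Fin I → (Fin dz → ℝ) → EReal)
    (c : Fin L → (Fin dz → ℝ) → EReal) (h : Fin J → (Fin dz → ℝ) → EReal)
    (μ : Fin J → ℝ) :
    Set ((Fin I → ℝ) × (Fin I → ℝ) × (Fin I → Fin J → ℝ) × (Fin I → Fin dz → ℝ)) :=
  {r | (∑ i, r.2.1 i) = 1 ∧ (∀ j, (∑ i, r.2.2.1 i j) ≤ μ j) ∧ (∀ i, 0 ≤ r.2.1 i) ∧
       (∀ i ℓ, adbpConC (J := J) c i ℓ r ≤ 0) ∧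
       (∀ i j, adbpConH (L := L) h i j r ≤ 0) ∧
       (∀ i, adbpConG (J := J) (L := L) gi i r ≤ 0)}

/-- Optimal value of (AD-B'). -/
def adbpVal {dz I J L : ℕ} (gi : Fin I → (Fin dz → ℝ) → EReal)
    (c : Fin L → (Fin dz → ℝ) → EReal) (h : Fin J → (Fin dz → ℝ) → EReal)
    (μ : Fin J → ℝ) : EReal :=
  ⨆ r ∈ adbpFeas gi c h μ, (((∑ i, r.1 i : ℝ)) : EReal)

/-- (AD-B') is solvable. -/
def adbpSolvable {dz I J L : ℕ} (gi : Fin I → (Fin dz → ℝ) → EReal)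
    (c : Fin L → (Fin dz → ℝ) → EReal) (h : Fin J → (Fin dz → ℝ) → EReal)
    (μ : Fin J → ℝ) : Prop :=
  adbpFeas gi c h μ = ∅ ∨
    ∃ r ∈ adbpFeas gi c h μ, (((∑ i, r.1 i : ℝ)) : EReal) = adbpVal gi c h μ

/-- Slater point of (AD-B') (whose further explicit constraints are the affine equality
`Σ_i λ_i = 1` and the linear inequalities `Σ_i ω_{ij} ≤ μ_j`, `λ ≥ 0`). -/
def SlaterADBP {dz I J L : ℕ} (gi : Fin I → (Fin dz → ℝ) → EReal)
    (c : Fin L → (Fin dz → ℝ) → EReal) (h : Fin J → (Fin dz → ℝ) → EReal)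
    (μ : Fin J → ℝ)
    (r : (Fin I → ℝ) × (Fin I → ℝ) × (Fin I → Fin J → ℝ) × (Fin I → Fin dz → ℝ)) :
    Prop :=
  (∀ i ℓ, r ∈ intrinsicInterior ℝ {s | adbpConC (J := J) c i ℓ s < ⊤}) ∧
  (∀ i j, r ∈ intrinsicInterior ℝ {s | adbpConH (L := L) h i j s < ⊤}) ∧
  (∀ i, r ∈ intrinsicInterior ℝ {s | adbpConG (J := J) (L := L) gi i s < ⊤}) ∧
  r ∈ adbpFeas gi c h μ ∧
  (∀ i ℓ, ¬ IsAffineCLM (adbpConC (dz := dz) (J := J) c i ℓ) →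
    adbpConC (J := J) c i ℓ r < 0) ∧
  (∀ i j, ¬ IsAffineCLM (adbpConH (dz := dz) (L := L) h i j) →
    adbpConH (L := L) h i j r < 0) ∧
  (∀ i, ¬ IsAffineCLM (adbpConG (dz := dz) (J := J) (L := L) gi i) →
    adbpConG (J := J) (L := L) gi i r < 0)

namespace UQ

open Filter Topology

/-- The projection of a closed set is closed when its fibers over bounded sets are bounded. -/
lemma isClosed_image_fst {X Z : Type*} [NormedAddCommGroup X] [NormedAddCommGroup Z]
    [ProperSpace Z] {T : Set (X × Z)} (hT : IsClosed T)
    (hb : ∀ R : ℝ, ∃ R' : ℝ, ∀ p ∈ T, ‖p.1‖ ≤ R → ‖p.2‖ ≤ R') :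
    IsClosed (Prod.fst '' T) := by
  rw [← isSeqClosed_iff_isClosed]
  intro x a hx hxa
  choose p hpT hpx using hx
  obtain ⟨R, hR⟩ := (Metric.isBounded_range_of_tendsto x hxa).exists_norm_le
  obtain ⟨R', hR'⟩ := hb R
  have hz : ∀ n, (p n).2 ∈ Metric.closedBall (0 : Z) R' := by
    intro n
    rw [mem_closedBall_zero_iff]
    refine hR' _ (hpT n) ?_
    rw [hpx n]
    exact hR _ ⟨n, rfl⟩
  obtain ⟨z, -, φ, hφ, hlim⟩ := tendsto_subseq_of_bounded Metric.isBounded_closedBall hz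
  refine ⟨(a, z), ?_, rfl⟩
  refine hT.mem_of_tendsto (b := atTop) (f := fun n => p (φ n)) ?_
    (Eventually.of_forall fun n => hpT _)
  rw [Prod.tendsto_iff]
  refine ⟨?_, hlim⟩
  have := hxa.comp hφ.tendsto_atTop
  refine this.congr fun n => ?_
  simp [hpx]

/-- If one fiber of a closed convex set is bounded, then the fibers are bounded uniformly over
bounded sets. -/
lemma bounded_fibers_of_convex {X Z : Type*} [NormedAddCommGroup X] [NormedSpace ℝ X]
    [NormedAddCommGroup Z] [NormedSpace ℝ Z] [ProperSpace Z] {Q : Set (Z × X)}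
    (hQ : IsClosed Q) (hc : Convex ℝ Q) {z₀ : Z} {x₀ : X} (h₀ : (z₀, x₀) ∈ Q) {ρ : ℝ}
    (hρ : 0 < ρ) (hb : ∀ z, (z, x₀) ∈ Q → ‖z - z₀‖ < ρ) (R : ℝ) :
    ∃ R' : ℝ, ∀ p ∈ Q, ‖p.2‖ ≤ R → ‖p.1‖ ≤ R' := by
  by_contra! hcon
  choose p hpQ hpR hpn using fun n : ℕ => hcon (n + ‖z₀‖ + ρ)
  have hn : ∀ n : ℕ, (n : ℝ) + ρ < ‖(p n).1 - z₀‖ := by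
    intro n
    have := norm_sub_norm_le (p n).1 z₀
    have := hpn n
    linarith
  have hpos : ∀ n : ℕ, 0 < ‖(p n).1 - z₀‖ := fun n => by
    have := hn n
    have : (0 : ℝ) ≤ n := n.cast_nonneg
    linarith
  set s : ℕ → ℝ := fun n => ρ / ‖(p n).1 - z₀‖ with hs
  have hs0 : ∀ n, 0 ≤ s n := fun n => (div_pos hρ (hpos n)).le
  have hs1 : ∀ n, s n ≤ 1 := fun n => by
    rw [hs, div_le_one (hpos n)]
    have := hn n
    have : (0 : ℝ) ≤ n := n.cast_nonneg
    linarith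
  have hslim : Tendsto s atTop (𝓝 0) := by
    refine Tendsto.div_atTop tendsto_const_nhds ?_
    refine tendsto_atTop_mono (fun n => (?_ : (n : ℝ) ≤ _)) tendsto_natCast_atTop_atTop
    have := hn n
    linarith
  set w : ℕ → Z × X := fun n => (z₀, x₀) + s n • (p n - (z₀, x₀)) with hw
  have hwQ : ∀ n, w n ∈ Q := fun n => hc.add_smul_sub_mem h₀ (hpQ n) ⟨hs0 n, hs1 n⟩
  have hw1 : ∀ n, (w n).1 ∈ Metric.sphere z₀ ρ := by
    intro n
    have h1 : (w n).1 = z₀ + s n • ((p n).1 - z₀) := rfl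
    rw [mem_sphere_iff_norm, h1, add_sub_cancel_left, norm_smul, Real.norm_of_nonneg (hs0 n), hs]
    exact div_mul_cancel₀ _ (hpos n).ne'
  have hw2 : Tendsto (fun n => (w n).2) atTop (𝓝 x₀) := by
    have h1 : Tendsto (fun n => s n • ((p n).2 - x₀)) atTop (𝓝 0) := by
      refine squeeze_zero_norm (a := fun n => s n * (R + ‖x₀‖)) ?_ (by simpa using hslim.mul_const _)
      intro n
      rw [norm_smul, Real.norm_of_nonneg (hs0 n)]
      refine mul_le_mul_of_nonneg_left ?_ (hs0 n)
      exact (norm_sub_le _ _).trans (by gcongr; exact hpR n)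
    simpa [hw] using h1.const_add x₀
  obtain ⟨z, hz, φ, hφ, hlim⟩ := (isCompact_sphere z₀ ρ).tendsto_subseq hw1
  have hzQ : (z, x₀) ∈ Q := by
    refine hQ.mem_of_tendsto (b := atTop) (f := fun n => w (φ n)) ?_
      (Eventually.of_forall fun n => hwQ _)
    rw [Prod.tendsto_iff]
    exact ⟨hlim, hw2.comp hφ.tendsto_atTop⟩
  have h1 := hb z hzQ
  rw [mem_sphere_iff_norm] at hz
  linarith

/-- A bound on all sums of a choice of elements splits into bounds on the individual sets. -/
lemma exists_upper_bounds_of_sum_le {K : Type*} [Fintype K] (A : K → Set ℝ)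
    (hA : ∀ k, (A k).Nonempty) {γ : ℝ}
    (h : ∀ a : K → ℝ, (∀ k, a k ∈ A k) → ∑ k, a k ≤ γ) :
    ∃ b : K → ℝ, (∀ k, ∀ a ∈ A k, a ≤ b k) ∧ ∑ k, b k ≤ γ := by
  choose a₀ ha₀ using hA
  have hbdd : ∀ k, BddAbove (A k) := by
    intro k
    refine ⟨γ - ∑ j, a₀ j + a₀ k, fun a ha => ?_⟩
    have h1 := h (Function.update a₀ k a) (fun j => by
      by_cases hj : j = k
      · subst hj; simpa using ha
      · simpa [hj] using ha₀ j)
    rw [Finset.sum_update_of_mem (Finset.mem_univ k)] at h1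
    have h2 := Finset.add_sum_erase Finset.univ a₀ (Finset.mem_univ k)
    rw [Finset.sdiff_singleton_eq_erase] at h1
    linarith
  refine ⟨fun k => sSup (A k), fun k a ha => le_csSup (hbdd k) ha, ?_⟩
  refine le_of_forall_pos_le_add fun ε hε => ?_
  have hc : (0 : ℝ) < Fintype.card K + 1 := by positivity
  have hex : ∀ k, ∃ a ∈ A k, sSup (A k) - ε / (Fintype.card K + 1) < a := fun k =>
    exists_lt_of_lt_csSup ⟨_, ha₀ k⟩ (sub_lt_self _ (div_pos hε hc))
  choose a ha hlt using hex
  calc ∑ k, sSup (A k) ≤ ∑ k, (a k + ε / (Fintype.card K + 1)) :=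
        Finset.sum_le_sum fun k _ => by linarith [hlt k]
    _ = ∑ k, a k + Fintype.card K * (ε / (Fintype.card K + 1)) := by
        simp [Finset.sum_add_distrib]
    _ ≤ γ + ε := by
        refine add_le_add (h a ha) ?_
        rw [mul_div_assoc', div_le_iff₀ hc]
        nlinarith

/-- Strict separation of a point from a closed convex subset of `X × ℝ`. -/
lemma exists_separation_prod {X : Type*} [NormedAddCommGroup X] [NormedSpace ℝ X]
    {S : Set (X × ℝ)} (hc : Convex ℝ S) (hS : IsClosed S) {x : X} {r : ℝ} (hx : (x, r) ∉ S) :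
    ∃ (y : X →L[ℝ] ℝ) (s γ : ℝ), (∀ p ∈ S, y p.1 - s * p.2 < γ) ∧ γ < y x - s * r := by
  obtain ⟨f, γ, h1, h2⟩ := geometric_hahn_banach_closed_point hc hS hx
  have hf : ∀ p : X × ℝ, f p = f.comp (ContinuousLinearMap.inl ℝ X ℝ) p.1 - (-f (0, 1)) * p.2 := by
    intro p
    have : p = (p.1, 0) + p.2 • ((0 : X), (1 : ℝ)) := by ext <;> simp
    conv_lhs => rw [this, map_add, map_smul]
    simp
    ring
  refine ⟨f.comp (ContinuousLinearMap.inl ℝ X ℝ), -f (0, 1), γ, fun p hp => ?_, ?_⟩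
  · rw [← hf]; exact h1 p hp
  · rw [← hf (x, r)]; exact h2

lemma exists_dotp {n : ℕ} (f : (Fin n → ℝ) →L[ℝ] ℝ) : ∃ w : Fin n → ℝ, ∀ x, f x = dotp w x := by
  refine ⟨fun i => f (Pi.single i 1), fun x => ?_⟩
  have := LinearMap.pi_apply_eq_sum_univ (f : (Fin n → ℝ) →ₗ[ℝ] ℝ) x
  simp only [ContinuousLinearMap.coe_coe] at this
  rw [this, dotp]
  refine Finset.sum_congr rfl fun i _ => ?_
  rw [smul_eq_mul, mul_comm]
  congr 2
  ext j
  simp [Pi.single_apply, eq_comm]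

lemma dotp_add {n : ℕ} (x y z : Fin n → ℝ) : dotp (x + y) z = dotp x z + dotp y z := by
  simp [dotp, add_mul, Finset.sum_add_distrib]

lemma dotp_smul {n : ℕ} (a : ℝ) (x z : Fin n → ℝ) : dotp (a • x) z = a * dotp x z := by
  simp [dotp, Finset.mul_sum, mul_assoc]

lemma dotp_comm {n : ℕ} (x y : Fin n → ℝ) : dotp x y = dotp y x := by
  simp [dotp, mul_comm]

lemma dotp_sum {n : ℕ} {ι : Type*} (s : Finset ι) (x : ι → Fin n → ℝ) (z : Fin n → ℝ) :
    dotp (∑ i ∈ s, x i) z = ∑ i ∈ s, dotp (x i) z := by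
  simp only [dotp, Finset.sum_apply, Finset.sum_mul]
  exact Finset.sum_comm

lemma dotp_zero {n : ℕ} (z : Fin n → ℝ) : dotp 0 z = 0 := by simp [dotp]

lemma eq_zero_of_dotp {n : ℕ} {w : Fin n → ℝ} (h : ∀ z, dotp w z = 0) : w = 0 := by
  ext i
  have := h (Pi.single i 1)
  simpa [dotp, Pi.single_apply] using this

/-- Real epigraph of an extended-real-valued function. -/
def epi {n : ℕ} (f : (Fin n → ℝ) → EReal) : Set ((Fin n → ℝ) × ℝ) := {p | f p.1 ≤ (p.2 : EReal)}

lemma isClosed_epi {n : ℕ} {f : (Fin n → ℝ) → EReal} (hf : ClosedFn f) : IsClosed (epi f) := by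
  have := hf.1.isClosed_epigraph
  exact this.preimage (continuous_fst.prodMk (continuous_coe_real_ereal.comp continuous_snd))

lemma epi_nonempty {n : ℕ} {f : (Fin n → ℝ) → EReal} (hf : ProperFn f) : (epi f).Nonempty := by
  obtain ⟨hb, x, hx⟩ := hf
  exact ⟨(x, (f x).toReal), (EReal.coe_toReal hx (hb x)).ge⟩

lemma exists_lower_bound_of_isBounded {n : ℕ} {f : (Fin n → ℝ) → EReal} (hp : ProperFn f)
    (hf : ClosedFn f) {B : Set (Fin n → ℝ)} (hB : Bornology.IsBounded B) :
    ∃ m : ℝ, 0 ≤ m ∧ ∀ x ∈ B, ((-m : ℝ) : EReal) ≤ f x := by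
  rcases B.eq_empty_or_nonempty with rfl | hne
  · exact ⟨0, le_rfl, by simp⟩
  obtain ⟨a, -, ha⟩ := LowerSemicontinuousOn.exists_isMinOn (hne.mono subset_closure)
    hB.isCompact_closure (hf.1.lowerSemicontinuousOn _)
  obtain ⟨m, hm⟩ : ∃ m : ℝ, (m : EReal) ≤ f a := by
    rcases eq_or_ne (f a) ⊤ with h | h
    · exact ⟨0, by simp [h]⟩
    · exact ⟨(f a).toReal, (EReal.coe_toReal h (hp.1 a)).le⟩
  refine ⟨|m|, abs_nonneg _, fun x hx => ?_⟩
  refine le_trans ?_ (hm.trans (ha (subset_closure hx)))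
  exact_mod_cast neg_abs_le m

lemma conjFn_le {n : ℕ} {f : (Fin n → ℝ) → EReal} (hb : ∀ x, f x ≠ ⊥) {w : Fin n → ℝ} {γ : ℝ}
    (h : ∀ p ∈ epi f, dotp w p.1 - p.2 ≤ γ) : conjFn f w ≤ (γ : EReal) := by
  refine iSup_le fun x => ?_
  induction hx : f x with
  | bot => exact absurd hx (hb x)
  | top => simp
  | coe t =>
    have := h (x, t) (by simp [epi, hx])
    exact_mod_cast this

lemma le_conjFn {n : ℕ} (f : (Fin n → ℝ) → EReal) (w x : Fin n → ℝ) {t : ℝ}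
    (h : f x ≤ (t : EReal)) : ((dotp w x - t : ℝ) : EReal) ≤ conjFn f w := by
  refine le_trans ?_ (le_iSup _ x)
  rw [EReal.coe_sub]
  exact EReal.sub_le_sub le_rfl h

/-- An upward closed set of `X × ℝ` can only be bounded above by functionals of the right sign. -/
lemma nonneg_of_forall_sub_mul_lt {a s γ t : ℝ} (h : ∀ t' ≥ t, a - s * t' < γ) : 0 ≤ s := by
  by_contra! hs
  have h1 := h t le_rfl
  have h2 := h (t + (γ - (a - s * t)) / (-s)) (by
    have : 0 ≤ (γ - (a - s * t)) / (-s) := div_nonneg (by linarith) (by linarith)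
    linarith)
  have h3 : s * ((γ - (a - s * t)) / (-s)) = -(γ - (a - s * t)) := by
    rw [div_neg, mul_neg, mul_div_cancel₀ _ hs.ne]
  nlinarith

/-- **Fenchel–Moreau**: a proper closed convex function lies below its biconjugate. -/
lemma le_biconj {n : ℕ} {f : (Fin n → ℝ) → EReal} (hp : ProperFn f) (hf : ClosedFn f)
    (hc : ConvexFn f) (x : Fin n → ℝ) : f x ≤ conjFn (conjFn f) x := by
  have hcl := isClosed_epi hf
  have hcv : Convex ℝ (epi f) := hc
  have hup : ∀ p ∈ epi f, ∀ t' ≥ p.2, (p.1, t') ∈ epi f := fun p hp t' ht' =>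
    show f p.1 ≤ (t' : EReal) from le_trans hp (EReal.coe_le_coe_iff.2 ht')
  have key : ∀ w γ, (∀ p ∈ epi f, dotp w p.1 - p.2 ≤ γ) →
      ((dotp w x - γ : ℝ) : EReal) ≤ conjFn (conjFn f) x := fun w γ h => by
    rw [dotp_comm]
    exact le_conjFn _ _ _ (conjFn_le hp.1 h)
  obtain ⟨⟨x₁, t₁⟩, h₁⟩ := epi_nonempty hp
  have hmin : ∃ w γ, ∀ p ∈ epi f, dotp w p.1 - p.2 ≤ γ := by
    have hx₁ : f x₁ ≠ ⊤ := fun h => by simp [epi, h] at h₁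
    have hval := EReal.coe_toReal hx₁ (hp.1 x₁)
    have hmem : (x₁, (f x₁).toReal) ∈ epi f := hval.ge
    have hnot : (x₁, (f x₁).toReal - 1) ∉ epi f := by
      intro h
      have h' : f x₁ ≤ (((f x₁).toReal - 1 : ℝ) : EReal) := h
      rw [← hval, EReal.toReal_coe, EReal.coe_le_coe_iff] at h'
      linarith
    obtain ⟨y, s, γ, hlt, hgt⟩ := exists_separation_prod hcv hcl hnot
    obtain ⟨w, hw⟩ := exists_dotp y
    have hs : 0 < s := by
      have := hlt _ hmem
      simp only at this
      nlinarith
    refine ⟨s⁻¹ • w, s⁻¹ * γ, fun p hp => ?_⟩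
    have h2 := hlt p hp
    rw [hw] at h2
    rw [dotp_smul]
    have : s⁻¹ * (dotp w p.1 - s * p.2) ≤ s⁻¹ * γ := by gcongr
    rw [mul_sub, inv_mul_cancel_left₀ hs.ne'] at this
    exact this
  obtain ⟨w₀, γ₀, hw₀⟩ := hmin
  refine EReal.le_of_forall_lt_iff_le.1 fun v hv => ?_
  by_contra! hlt
  have hnot : (x, v) ∉ epi f := fun h => absurd (show f x ≤ v from h) (not_le.2 hlt)
  obtain ⟨y, s, γ, hl, hg⟩ := exists_separation_prod hcv hcl hnot
  obtain ⟨w, hw⟩ := exists_dotp y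
  rw [hw] at hg
  have hs : 0 ≤ s := nonneg_of_forall_sub_mul_lt (a := y x₁) (γ := γ) (t := t₁) fun t' ht' =>
    hl _ (hup _ h₁ t' ht')
  rcases hs.eq_or_lt with rfl | hs
  · have hd : 0 < dotp w x - γ := by linarith
    set k := max 0 ((v - (dotp w₀ x - γ₀)) / (dotp w x - γ)) with hk
    have hk0 : 0 ≤ k := le_max_left _ _
    have h2 := key (w₀ + k • w) (γ₀ + k * γ) (fun p hp => by
      rw [dotp_add, dotp_smul]
      have h3 := hl p hp
      rw [hw] at h3
      have := hw₀ p hp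
      nlinarith)
    have h3 : v ≤ dotp (w₀ + k • w) x - (γ₀ + k * γ) := by
      rw [dotp_add, dotp_smul]
      have : (v - (dotp w₀ x - γ₀)) ≤ k * (dotp w x - γ) := by
        rw [← div_le_iff₀ hd]
        exact le_max_right _ _
      linarith
    have := hv.trans_le ((EReal.coe_le_coe_iff.2 h3).trans h2)
    exact lt_irrefl _ this
  · have h2 := key (s⁻¹ • w) (s⁻¹ * γ) (fun p hp => by
      have h3 := hl p hp
      rw [hw] at h3
      rw [dotp_smul]
      have : s⁻¹ * (dotp w p.1 - s * p.2) ≤ s⁻¹ * γ := by gcongr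
      rw [mul_sub, inv_mul_cancel_left₀ hs.ne'] at this
      exact this)
    have h3 : v ≤ dotp (s⁻¹ • w) x - s⁻¹ * γ := by
      rw [dotp_smul]
      have : s⁻¹ * γ ≤ s⁻¹ * (dotp w x - s * v) := by gcongr
      rw [mul_sub, inv_mul_cancel_left₀ hs.ne'] at this
      linarith
    have := hv.trans_le ((EReal.coe_le_coe_iff.2 h3).trans h2)
    exact lt_irrefl _ this

lemma clm_eq_sum_single {ι V : Type*} [Fintype ι] [NormedAddCommGroup V] [NormedSpace ℝ V]
    (f : (ι → V) →L[ℝ] ℝ) (x : ι → V) :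
    f x = ∑ i, f.comp (ContinuousLinearMap.single ℝ (fun _ : ι => V) i) (x i) := by
  conv_lhs => rw [← Finset.univ_sum_single x, map_sum]
  simp

/-- Lagrange–Fenchel multipliers for the minimization of `∑ k, w k * φ k` over a bounded convex
feasible set, with objective functions and constraints given through their epigraphs. -/
lemma exists_multipliers {n : ℕ} {K M : Type*} [Fintype K] [Fintype M]
    (Φ : K → Set ((Fin n → ℝ) × ℝ)) (C : M → Set ((Fin n → ℝ) × ℝ)) (w : K → ℝ)
    (hw : ∀ k, 0 < w k) (hΦc : ∀ k, IsClosed (Φ k)) (hΦv : ∀ k, Convex ℝ (Φ k))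
    (hCc : ∀ l, IsClosed (C l)) (hCv : ∀ l, Convex ℝ (C l))
    (hCup : ∀ l, ∀ p ∈ C l, ∀ t ≥ p.2, (p.1, t) ∈ C l)
    (hΦb : ∀ k (R : ℝ), ∃ m : ℝ, ∀ p ∈ Φ k, ‖p.1‖ ≤ R → -m ≤ p.2)
    (z₀ : Fin n → ℝ) (t₀ : K → ℝ) (hz₀ : ∀ k, (z₀, t₀ k) ∈ Φ k) (hz₀C : ∀ l, (z₀, 0) ∈ C l)
    (hbd : Bornology.IsBounded {z : Fin n → ℝ | ∀ l, (z, 0) ∈ C l}) (a : ℝ)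
    (ha : ∀ (z : Fin n → ℝ) (t : K → ℝ), (∀ k, (z, t k) ∈ Φ k) → (∀ l, (z, 0) ∈ C l) →
      -a ≤ ∑ k, w k * t k) {δ : ℝ} (hδ : 0 < δ) :
    ∃ (y : K → Fin n → ℝ) (y' : M → Fin n → ℝ) (ν : M → ℝ) (b : K → ℝ) (b' : M → ℝ),
      ∑ k, y k + ∑ l, y' l = 0 ∧ (∀ l, 0 ≤ ν l) ∧
      (∀ k, ∀ p ∈ Φ k, dotp (y k) p.1 - w k * p.2 ≤ b k) ∧
      (∀ l, ∀ p ∈ C l, dotp (y' l) p.1 - ν l * p.2 ≤ b' l) ∧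
      ∑ k, b k + ∑ l, b' l ≤ a + δ := by
  set T : Set ((((K → Fin n → ℝ) × (M → Fin n → ℝ) × (M → ℝ)) × ℝ) × (Fin n → ℝ) × (K → ℝ)) :=
    {p | (∀ k, (p.2.1 + p.1.1.1 k, p.2.2 k) ∈ Φ k) ∧
      (∀ l, (p.2.1 + p.1.1.2.1 l, p.1.1.2.2 l) ∈ C l) ∧ ∑ k, w k * p.2.2 k ≤ p.1.2} with hT
  have hTc : IsClosed T := by
    simp only [hT, Set.ofPred_and, Set.ofPred_forall]
    refine (isClosed_iInter fun k => (hΦc k).preimage (by fun_prop)).inter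
      ((isClosed_iInter fun l => (hCc l).preimage (by fun_prop)).inter
        (isClosed_le (by fun_prop) (by fun_prop)))
  have hTv : Convex ℝ T := by
    rintro p ⟨hp1, hp2, hp3⟩ q ⟨hq1, hq2, hq3⟩ α β hα hβ hαβ
    refine ⟨fun k => ?_, fun l => ?_, ?_⟩
    · convert hΦv k (hp1 k) (hq1 k) hα hβ hαβ using 1
      ext <;> simp
      all_goals ring
    · convert hCv l (hp2 l) (hq2 l) hα hβ hαβ using 1
      ext <;> simp
      all_goals ring
    · have : ∑ k, w k * (α • p + β • q).2.2 k
          = α * ∑ k, w k * p.2.2 k + β * ∑ k, w k * q.2.2 k := by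
        rw [Finset.mul_sum, Finset.mul_sum, ← Finset.sum_add_distrib]
        refine Finset.sum_congr rfl fun k _ => ?_
        simp
        ring
      rw [this]
      simp only [Prod.fst_add, Prod.smul_fst, Prod.snd_add, Prod.smul_snd, smul_eq_mul]
      gcongr
  -- boundedness of the `z` component
  obtain ⟨ρ, hρ0, hρ⟩ : ∃ ρ : ℝ, 0 < ρ ∧ ∀ z, (∀ l, (z, (0 : ℝ)) ∈ C l) → ‖z - z₀‖ < ρ := by
    obtain ⟨r, hr⟩ := hbd.exists_norm_le
    refine ⟨|r| + ‖z₀‖ + 1, by positivity, fun z hz => ?_⟩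
    have h1 := hr z hz
    have h2 := norm_sub_le z z₀
    have h3 := le_abs_self r
    linarith
  have hTz : ∀ R : ℝ, ∃ R' : ℝ, ∀ p ∈ T, ‖p.1‖ ≤ R → ‖p.2.1‖ ≤ R' := by
    intro R
    set Q : Set ((Fin n → ℝ) × (M → Fin n → ℝ) × (M → ℝ)) :=
      {p | ∀ l, (p.1 + p.2.1 l, p.2.2 l) ∈ C l} with hQ
    have hQc : IsClosed Q := by
      simp only [hQ, Set.ofPred_forall]
      exact isClosed_iInter fun l => (hCc l).preimage (by fun_prop)
    have hQv : Convex ℝ Q := by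
      intro p hp q hq α β hα hβ hαβ l
      convert hCv l (hp l) (hq l) hα hβ hαβ using 1
      ext <;> simp
      all_goals ring
    obtain ⟨R', hR'⟩ := bounded_fibers_of_convex hQc hQv (z₀ := z₀) (x₀ := 0)
      (fun l => by simpa using hz₀C l) hρ0
      (fun z hz => hρ z fun l => by simpa using hz l) R
    refine ⟨R', fun p hp hpR => hR' (p.2.1, p.1.1.2) hp.2.1 ?_⟩
    exact (norm_snd_le p.1.1).trans ((norm_fst_le p.1).trans hpR)
  have hTb : ∀ R : ℝ, ∃ R' : ℝ, ∀ p ∈ T, ‖p.1‖ ≤ R → ‖p.2‖ ≤ R' := by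
    intro R
    obtain ⟨R₁, hR₁⟩ := hTz R
    choose m hm using fun k => hΦb k (R₁ + R)
    have hlow : ∀ p ∈ T, ‖p.1‖ ≤ R → ∀ k, -|m k| ≤ p.2.2 k := by
      intro p hp hpR k
      refine le_trans (neg_le_neg (le_abs_self _)) (hm k _ (hp.1 k) ?_)
      refine (norm_add_le _ _).trans (add_le_add (hR₁ p hp hpR) ?_)
      exact (norm_le_pi_norm p.1.1.1 k).trans
        ((norm_fst_le p.1.1).trans ((norm_fst_le p.1).trans hpR))
    have hup : ∀ p ∈ T, ‖p.1‖ ≤ R → ∀ k, w k * p.2.2 k ≤ R + ∑ j, w j * |m j| := by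
      intro p hp hpR k
      have h1 : w k * p.2.2 k + w k * |m k| ≤ ∑ j, (w j * p.2.2 j + w j * |m j|) :=
        Finset.single_le_sum (f := fun j => w j * p.2.2 j + w j * |m j|) (fun j _ => by
          have := hlow p hp hpR j
          have := mul_le_mul_of_nonneg_left this (hw j).le
          linarith) (Finset.mem_univ k)
      rw [Finset.sum_add_distrib] at h1
      have h2 : p.1.2 ≤ R := (le_abs_self _).trans ((norm_snd_le p.1).trans hpR)
      have h3 := hp.2.2
      have h4 : 0 ≤ w k * |m k| := mul_nonneg (hw k).le (abs_nonneg _)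
      linarith
    set D : ℝ := |R + (∑ j, w j * |m j|)| with hD
    have hD0 : 0 ≤ D := abs_nonneg _
    set B : ℝ := ∑ k, (|m k| + D / w k) with hB
    have hBk : ∀ k, |m k| + D / w k ≤ B := fun k =>
      Finset.single_le_sum (f := fun k => |m k| + D / w k)
        (fun j _ => add_nonneg (abs_nonneg _) (div_nonneg hD0 (hw j).le))
        (Finset.mem_univ k)
    refine ⟨max R₁ B, fun p hp hpR => ?_⟩
    rw [Prod.norm_def]
    refine max_le_max (hR₁ p hp hpR) ?_
    have hB0 : 0 ≤ B := Finset.sum_nonneg fun j _ =>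
      add_nonneg (abs_nonneg _) (div_nonneg hD0 (hw j).le)
    refine (pi_norm_le_iff_of_nonneg hB0).2 fun k => ?_
    rw [Real.norm_eq_abs, abs_le]
    have h1 := hlow p hp hpR k
    have h2 : p.2.2 k ≤ D / w k := by
      rw [le_div_iff₀ (hw k), mul_comm]
      exact (hup p hp hpR k).trans (le_abs_self _)
    have h3 := hBk k
    have h4 := abs_nonneg (m k)
    have h5 : 0 ≤ D / w k := div_nonneg hD0 (hw k).le
    exact ⟨by linarith, by linarith⟩
  have hSc := isClosed_image_fst hTc hTb
  have hSv : Convex ℝ (Prod.fst '' T) := hTv.linear_image (LinearMap.fst ℝ _ _)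
  have hnot : ((0 : (K → Fin n → ℝ) × (M → Fin n → ℝ) × (M → ℝ)), -a - δ) ∉ Prod.fst '' T := by
    rintro ⟨⟨x, z, t⟩, ⟨h1, h2, h3⟩, rfl⟩
    have := ha z t (fun k => by simpa using h1 k) (fun l => by simpa using h2 l)
    simp only at h3
    linarith
  obtain ⟨f, s, γ, hlt, hgt⟩ := exists_separation_prod hSv hSc hnot
  rw [map_zero] at hgt
  have hs : 0 < s := by
    have h1 := hlt (0, ∑ k, w k * t₀ k) ⟨((0, ∑ k, w k * t₀ k), z₀, t₀),
      ⟨fun k => by simpa using hz₀ k, fun l => by simpa using hz₀C l, le_rfl⟩, rfl⟩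
    rw [map_zero] at h1
    have h2 := ha z₀ t₀ hz₀ hz₀C
    simp only at h1
    nlinarith
  choose Y hY using fun k => exists_dotp (s⁻¹ • (f.comp
    (ContinuousLinearMap.inl ℝ (K → Fin n → ℝ) ((M → Fin n → ℝ) × (M → ℝ)))).comp
      (ContinuousLinearMap.single ℝ (fun _ : K => Fin n → ℝ) k))
  choose Y' hY' using fun l => exists_dotp (s⁻¹ • ((f.comp
    (ContinuousLinearMap.inr ℝ (K → Fin n → ℝ) ((M → Fin n → ℝ) × (M → ℝ)))).comp
      (ContinuousLinearMap.inl ℝ (M → Fin n → ℝ) (M → ℝ))).comp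
      (ContinuousLinearMap.single ℝ (fun _ : M => Fin n → ℝ) l))
  set N : M → ℝ := fun l => -(s⁻¹ * ((f.comp
    (ContinuousLinearMap.inr ℝ (K → Fin n → ℝ) ((M → Fin n → ℝ) × (M → ℝ)))).comp
      (ContinuousLinearMap.inr ℝ (M → Fin n → ℝ) (M → ℝ))).comp
      (ContinuousLinearMap.single ℝ (fun _ : M => ℝ) l) 1) with hN
  have hf : ∀ x : (K → Fin n → ℝ) × (M → Fin n → ℝ) × (M → ℝ), s⁻¹ * f x =
      ∑ k, dotp (Y k) (x.1 k) + ∑ l, dotp (Y' l) (x.2.1 l) - ∑ l, N l * x.2.2 l := by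
    intro x
    have hx : f x = (f.comp
        (ContinuousLinearMap.inl ℝ (K → Fin n → ℝ) ((M → Fin n → ℝ) × (M → ℝ)))) x.1 + ((f.comp
        (ContinuousLinearMap.inr ℝ (K → Fin n → ℝ) ((M → Fin n → ℝ) × (M → ℝ)))).comp
        (ContinuousLinearMap.inl ℝ (M → Fin n → ℝ) (M → ℝ))) x.2.1 + ((f.comp
        (ContinuousLinearMap.inr ℝ (K → Fin n → ℝ) ((M → Fin n → ℝ) × (M → ℝ)))).comp
        (ContinuousLinearMap.inr ℝ (M → Fin n → ℝ) (M → ℝ))) x.2.2 := by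
      simp only [ContinuousLinearMap.comp_apply, ← map_add]
      congr 1
      ext <;> simp
    rw [hx, clm_eq_sum_single, clm_eq_sum_single (ι := M) (V := Fin n → ℝ),
      clm_eq_sum_single (ι := M) (V := ℝ), mul_add, mul_add, Finset.mul_sum, Finset.mul_sum,
      Finset.mul_sum, sub_eq_add_neg, ← Finset.sum_neg_distrib]
    congr 1
    · congr 1
      · exact Finset.sum_congr rfl fun k _ => hY k _
      · exact Finset.sum_congr rfl fun k _ => hY' k _
    · refine Finset.sum_congr rfl fun l _ => ?_
      have h1 : x.2.2 l = x.2.2 l • (1 : ℝ) := by simp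
      conv_lhs => rw [h1, map_smul, smul_eq_mul]
      rw [hN]
      ring
  have hmain : ∀ (z : Fin n → ℝ) (p : K → (Fin n → ℝ) × ℝ) (q : M → (Fin n → ℝ) × ℝ),
      (∀ k, p k ∈ Φ k) → (∀ l, q l ∈ C l) →
      ∑ k, (dotp (Y k) (p k).1 - w k * (p k).2) + ∑ l, (dotp (Y' l) (q l).1 - N l * (q l).2)
        - dotp (∑ k, Y k + ∑ l, Y' l) z ≤ a + δ := by
    intro z p q hp hq
    have h1 := hlt ((fun k => (p k).1 - z, fun l => (q l).1 - z, fun l => (q l).2),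
      ∑ k, w k * (p k).2) ⟨(((fun k => (p k).1 - z, fun l => (q l).1 - z, fun l => (q l).2),
        ∑ k, w k * (p k).2), z, fun k => (p k).2), ⟨fun k => by simpa using hp k, fun l => by simpa using hq l,
          le_rfl⟩, rfl⟩
    have h2 := hf (fun k => (p k).1 - z, fun l => (q l).1 - z, fun l => (q l).2)
    have h3 : f (fun k => (p k).1 - z, fun l => (q l).1 - z, fun l => (q l).2)
        - s * ∑ k, w k * (p k).2 ≤ s * (a + δ) := by
      simp only at h1
      linarith
    have h4 := mul_le_mul_of_nonneg_left h3 (inv_pos.2 hs).le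
    rw [inv_mul_cancel_left₀ hs.ne', mul_sub, inv_mul_cancel_left₀ hs.ne', h2] at h4
    have h5 : ∀ (u v : Fin n → ℝ), dotp u (v - z) = dotp u v - dotp u z := by
      intro u v
      simp [dotp, mul_sub, Finset.sum_sub_distrib]
    simp only [h5, Finset.sum_sub_distrib] at h4
    rw [dotp_add, dotp_sum, dotp_sum, Finset.sum_sub_distrib, Finset.sum_sub_distrib]
    linarith
  have hzero : ∑ k, Y k + ∑ l, Y' l = 0 := by
    refine eq_zero_of_dotp fun z => ?_
    by_contra hne
    have h1 := hmain ((-(a + δ - (∑ k, (dotp (Y k) z₀ - w k * t₀ k) +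
      ∑ l, (dotp (Y' l) z₀ - N l * 0)) + 1) / dotp (∑ k, Y k + ∑ l, Y' l) z) • z)
      (fun k => (z₀, t₀ k)) (fun l => (z₀, 0)) hz₀ hz₀C
    rw [dotp_comm _ (_ • z), dotp_smul, dotp_comm z, div_mul_cancel₀ _ hne] at h1
    simp only at h1
    linarith
  have hNn : ∀ l, 0 ≤ N l := by
    intro l
    refine nonneg_of_forall_sub_mul_lt (t := 0) (γ := a + δ + 1)
      (a := ∑ k, (dotp (Y k) z₀ - w k * t₀ k) + ∑ l, dotp (Y' l) z₀) fun t ht => ?_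
    have h1 := hmain 0 (fun k => (z₀, t₀ k)) (fun j => (z₀, (Pi.single l t : M → ℝ) j)) hz₀ (fun j => by
      refine hCup j _ (hz₀C j) _ ?_
      by_cases hj : j = l
      · subst hj; simpa using ht
      · simp [hj])
    rw [hzero, dotp_zero, Finset.sum_sub_distrib (f := fun l => dotp (Y' l) z₀)] at h1
    have h2 : ∑ j, N j * (Pi.single l t : M → ℝ) j = N l * t := by
      rw [Finset.sum_eq_single l]
      · simp
      · intro j _ hj; simp [hj]
      · simp
    rw [h2] at h1
    linarith
  obtain ⟨b, hb, hbs⟩ := exists_upper_bounds_of_sum_le (K := K ⊕ M) (γ := a + δ)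
    (Sum.elim (fun k => (fun p : (Fin n → ℝ) × ℝ => dotp (Y k) p.1 - w k * p.2) '' Φ k)
      (fun l => (fun p : (Fin n → ℝ) × ℝ => dotp (Y' l) p.1 - N l * p.2) '' C l))
    (by
      rintro (k | l)
      · exact ⟨_, _, hz₀ k, rfl⟩
      · exact ⟨_, _, hz₀C l, rfl⟩)
    (by
      intro A hA
      choose p hp hpA using fun k => hA (Sum.inl k)
      choose q hq hqA using fun l => hA (Sum.inr l)
      have := hmain 0 p q hp hq
      rw [hzero, dotp_zero, sub_zero] at this
      rw [Fintype.sum_sum_type]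
      simpa only [← hpA, ← hqA] using this)
  refine ⟨Y, Y', N, fun k => b (Sum.inl k), fun l => b (Sum.inr l), hzero, hNn,
    fun k p hp => hb (Sum.inl k) _ ⟨p, hp, rfl⟩, fun l p hp => hb (Sum.inr l) _ ⟨p, hp, rfl⟩, ?_⟩
  rwa [Fintype.sum_sum_type] at hbs

/-- The directions `(0, ω, τ)` with `ω ≥ 0` and `τ ≤ 0`. -/
def upDirs (n J : ℕ) : Set ((Fin n → ℝ) × (Fin J → ℝ) × ℝ) :=
  {q | q.1 = 0 ∧ (∀ j, 0 ≤ q.2.1 j) ∧ q.2.2 ≤ 0}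

/-- The closed conic hull of `{1} × U` for a set `U` with directions of recession `upDirs`. -/
def pcone {n J : ℕ} (U : Set ((Fin n → ℝ) × (Fin J → ℝ) × ℝ)) :
    Set (ℝ × (Fin n → ℝ) × (Fin J → ℝ) × ℝ) :=
  {p | 0 ≤ p.1 ∧ (0 < p.1 → p.1⁻¹ • p.2 ∈ U) ∧ (p.1 = 0 → p.2 ∈ upDirs n J)}

/-- Closed convex sets that are bounded up to the directions in `upDirs`. -/
structure IsAugmented {n J : ℕ} (U : Set ((Fin n → ℝ) × (Fin J → ℝ) × ℝ)) (R m M : ℝ) :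
    Prop where
  closed : IsClosed U
  convex : Convex ℝ U
  nonempty : U.Nonempty
  upward : ∀ q ∈ U, ∀ d ∈ upDirs n J, q + d ∈ U
  norm_le : ∀ q ∈ U, ‖q.1‖ ≤ R
  neg_le : ∀ q ∈ U, ∀ j, -m ≤ q.2.1 j
  le : ∀ q ∈ U, q.2.2 ≤ M

section

variable {n J : ℕ} {U : Set ((Fin n → ℝ) × (Fin J → ℝ) × ℝ)} {R m M : ℝ}

lemma pcone_bounds (hU : IsAugmented U R m M) {p : ℝ × (Fin n → ℝ) × (Fin J → ℝ) × ℝ}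
    (hp : p ∈ pcone U) :
    ‖p.2.1‖ ≤ R * p.1 ∧ (∀ j, -m * p.1 ≤ p.2.2.1 j) ∧ p.2.2.2 ≤ M * p.1 := by
  obtain ⟨h0, h1, h2⟩ := hp
  rcases h0.eq_or_lt with h | h
  · obtain ⟨h3, h4, h5⟩ := h2 h.symm
    rw [← h]
    simpa [h3] using ⟨h4, h5⟩
  · have hq := h1 h
    have hn := hU.norm_le _ hq
    have hl := hU.neg_le _ hq
    have hle := hU.le _ hq
    simp only [Prod.smul_fst, Prod.smul_snd, norm_smul, norm_inv, Real.norm_of_nonneg h0,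
      Pi.smul_apply, smul_eq_mul] at hn hl hle
    refine ⟨?_, fun j => ?_, ?_⟩
    · rwa [inv_mul_le_iff₀ h, mul_comm] at hn
    · have := hl j
      rwa [le_inv_mul_iff₀ h, mul_comm] at this
    · rwa [inv_mul_le_iff₀ h, mul_comm] at hle

lemma isClosed_pcone (hU : IsAugmented U R m M) : IsClosed (pcone U) := by
  rw [← isSeqClosed_iff_isClosed]
  intro p a hp hpa
  have h1 : Tendsto (fun k => (p k).1) atTop (𝓝 a.1) := hpa.fst_nhds
  have h2 : Tendsto (fun k => (p k).2) atTop (𝓝 a.2) := hpa.snd_nhds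
  refine ⟨ge_of_tendsto' h1 fun k => (hp k).1, fun ha => ?_, fun ha => ?_⟩
  · refine hU.closed.mem_of_tendsto ((h1.inv₀ ha.ne').smul h2) ?_
    filter_upwards [h1.eventually (lt_mem_nhds ha)] with k hk
    exact (hp k).2.1 hk
  · rw [ha] at h1
    refine ⟨?_, fun j => ?_, ?_⟩
    · rw [← norm_le_zero_iff]
      refine le_of_tendsto_of_tendsto' h2.fst_nhds.norm
        (by simpa using h1.const_mul R) fun k => (pcone_bounds hU (hp k)).1
    · exact le_of_tendsto_of_tendsto' (by simpa using h1.const_mul (-m))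
        (tendsto_pi_nhds.1 h2.snd_nhds.fst_nhds j) fun k => (pcone_bounds hU (hp k)).2.1 j
    · exact le_of_tendsto_of_tendsto' h2.snd_nhds.snd_nhds
        (by simpa using h1.const_mul M) fun k => (pcone_bounds hU (hp k)).2.2

lemma smul_mem_pcone {p : ℝ × (Fin n → ℝ) × (Fin J → ℝ) × ℝ} (hp : p ∈ pcone U) {a : ℝ}
    (ha : 0 ≤ a) : a • p ∈ pcone U := by
  rcases ha.eq_or_lt with rfl | ha
  · rw [zero_smul]
    exact ⟨le_rfl, fun h => absurd h (lt_irrefl _), fun _ => ⟨rfl, fun _ => le_rfl, le_rfl⟩⟩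
  obtain ⟨h0, h1, h2⟩ := hp
  refine ⟨mul_nonneg ha.le h0, fun h => ?_, fun h => ?_⟩
  · have hp : 0 < p.1 := pos_of_mul_pos_right h ha.le
    convert h1 hp using 1
    simp only [Prod.smul_fst, Prod.smul_snd, smul_eq_mul, smul_smul]
    congr 1
    field_simp
  · have hp : p.1 = 0 := (mul_eq_zero.1 h).resolve_left ha.ne'
    obtain ⟨h3, h4, h5⟩ := h2 hp
    refine ⟨by simp [h3], fun j => mul_nonneg ha.le (h4 j), mul_nonpos_of_nonneg_of_nonpos ha.le h5⟩

lemma add_mem_pcone (hU : IsAugmented U R m M) {p q : ℝ × (Fin n → ℝ) × (Fin J → ℝ) × ℝ}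
    (hp : p ∈ pcone U) (hq : q ∈ pcone U) : p + q ∈ pcone U := by
  have hdir : ∀ d ∈ upDirs n J, ∀ a : ℝ, 0 < a → a⁻¹ • d ∈ upDirs n J := fun d hd a ha =>
    ⟨by simp [hd.1], fun j => mul_nonneg (inv_pos.2 ha).le (hd.2.1 j),
      mul_nonpos_of_nonneg_of_nonpos (inv_pos.2 ha).le hd.2.2⟩
  obtain ⟨hp0, hp1, hp2⟩ := hp
  obtain ⟨hq0, hq1, hq2⟩ := hq
  refine ⟨add_nonneg hp0 hq0, fun h => ?_, fun h => ?_⟩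
  · rcases hp0.eq_or_lt with hp | hp
    · have hq : 0 < q.1 := by simpa [← hp] using h
      convert hU.upward _ (hq1 hq) _ (hdir _ (hp2 hp.symm) _ hq) using 1
      simp [← hp, smul_add, add_comm]
    · rcases hq0.eq_or_lt with hq | hq
      · convert hU.upward _ (hp1 hp) _ (hdir _ (hq2 hq.symm) _ hp) using 1
        simp [← hq, smul_add]
      · convert hU.convex (hp1 hp) (hq1 hq) (a := p.1 / (p.1 + q.1)) (b := q.1 / (p.1 + q.1))
          (by positivity) (by positivity) (by field_simp) using 1
        rw [smul_smul, smul_smul, Prod.fst_add, Prod.snd_add, smul_add]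
        congr 2 <;> field_simp
  · have hp : p.1 = 0 := by
      have : p.1 + q.1 = 0 := h
      linarith
    have hq : q.1 = 0 := by
      have : p.1 + q.1 = 0 := h
      linarith
    obtain ⟨a1, a2, a3⟩ := hp2 hp
    obtain ⟨b1, b2, b3⟩ := hq2 hq
    exact ⟨by simp [a1, b1], fun j => add_nonneg (a2 j) (b2 j), add_nonpos a3 b3⟩

lemma mem_pcone_of_mem {q : (Fin n → ℝ) × (Fin J → ℝ) × ℝ} (hq : q ∈ U) : (1, q) ∈ pcone U :=
  ⟨zero_le_one, fun _ => by simpa using hq, fun h => absurd h one_ne_zero⟩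

lemma zero_mem_pcone : (0 : ℝ × (Fin n → ℝ) × (Fin J → ℝ) × ℝ) ∈ pcone U :=
  ⟨le_rfl, fun h => absurd h (lt_irrefl _), fun _ => ⟨rfl, fun _ => le_rfl, le_rfl⟩⟩

end

/-- The pairs `(u, t)` dominated by a mixture of the projections of the sets `U i`. -/
def mixSet {n I J : ℕ} (U : Fin I → Set ((Fin n → ℝ) × (Fin J → ℝ) × ℝ)) :
    Set ((Fin J → ℝ) × ℝ) :=
  {d | ∃ r : Fin I → ℝ × (Fin n → ℝ) × (Fin J → ℝ) × ℝ, (∀ i, r i ∈ pcone (U i)) ∧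
    ∑ i, (r i).1 = 1 ∧ (∀ j, ∑ i, (r i).2.2.1 j ≤ d.1 j) ∧ d.2 ≤ ∑ i, (r i).2.2.2}

section

variable {n I J : ℕ} {U : Fin I → Set ((Fin n → ℝ) × (Fin J → ℝ) × ℝ)} {R m M : ℝ}

lemma convex_mixSet (hU : ∀ i, IsAugmented (U i) R m M) : Convex ℝ (mixSet U) := by
  rintro d ⟨r, h1, h2, h3, h4⟩ e ⟨s, k1, k2, k3, k4⟩ a b ha hb hab
  refine ⟨fun i => a • r i + b • s i, fun i => add_mem_pcone (hU i) (smul_mem_pcone (h1 i) ha)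
    (smul_mem_pcone (k1 i) hb), ?_, fun j => ?_, ?_⟩
  · simp [Finset.sum_add_distrib, ← Finset.mul_sum, h2, k2, hab]
  · have h := h3 j
    have k := k3 j
    simp only [Prod.snd_add, Prod.smul_snd, Prod.fst_add, Prod.smul_fst, Pi.add_apply,
      Pi.smul_apply, smul_eq_mul, Finset.sum_add_distrib, ← Finset.mul_sum]
    gcongr
  · simp only [Prod.snd_add, Prod.smul_snd,
      smul_eq_mul, Finset.sum_add_distrib, ← Finset.mul_sum]
    gcongr

lemma isClosed_mixSet (hR : 0 ≤ R) (hm : 0 ≤ m) (hM : 0 ≤ M)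
    (hU : ∀ i, IsAugmented (U i) R m M) : IsClosed (mixSet U) := by
  set T : Set (((Fin J → ℝ) × ℝ) × (Fin I → ℝ × (Fin n → ℝ) × (Fin J → ℝ) × ℝ)) :=
    {p | (∀ i, p.2 i ∈ pcone (U i)) ∧ ∑ i, (p.2 i).1 = 1 ∧
      (∀ j, ∑ i, (p.2 i).2.2.1 j ≤ p.1.1 j) ∧ p.1.2 ≤ ∑ i, (p.2 i).2.2.2} with hT
  have himg : mixSet U = Prod.fst '' T := by
    ext d
    constructor
    · rintro ⟨r, hr⟩
      exact ⟨(d, r), hr, rfl⟩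
    · rintro ⟨⟨d, r⟩, hr, rfl⟩
      exact ⟨r, hr⟩
  rw [himg]
  refine isClosed_image_fst ?_ fun R₀ => ?_
  · simp only [hT, Set.ofPred_and, Set.ofPred_forall]
    exact (isClosed_iInter fun i => (isClosed_pcone (hU i)).preimage (by fun_prop)).inter
      ((isClosed_eq (by fun_prop) (by fun_prop)).inter
        ((isClosed_iInter fun j => isClosed_le (by fun_prop) (by fun_prop)).inter
          (isClosed_le (by fun_prop) (by fun_prop))))
  · set B : ℝ := 1 + R + |R₀| + (I + 1) * m + (I + 1) * M with hB
    have hI : (0 : ℝ) ≤ I := I.cast_nonneg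
    refine ⟨B, ?_⟩
    rintro ⟨d, r⟩ ⟨h1, h2, h3, h4⟩ hd
    simp only at h1 h2 h3 h4 hd ⊢
    have hB0 : 0 ≤ B := by positivity
    have hIm : 0 ≤ I * m := by positivity
    have hIM : 0 ≤ I * M := by positivity
    have hR0 := abs_nonneg R₀
    have hR0' := le_abs_self R₀
    refine (pi_norm_le_iff_of_nonneg hB0).2 fun i => ?_
    have hl0 : ∀ k, 0 ≤ (r k).1 := fun k => (h1 k).1
    have hl1 : ∀ k, (r k).1 ≤ 1 := fun k => by
      rw [← h2]
      exact Finset.single_le_sum (f := fun k => (r k).1) (fun k _ => hl0 k) (Finset.mem_univ k)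
    have hb := fun k => pcone_bounds (hU k) (h1 k)
    have hω : ∀ k j, -m ≤ (r k).2.2.1 j := fun k j => by
      have := (hb k).2.1 j
      nlinarith [hl0 k, hl1 k]
    have hτ : ∀ k, (r k).2.2.2 ≤ M := fun k => by
      have := (hb k).2.2
      nlinarith [hl0 k, hl1 k]
    have hω' : ∀ j, (r i).2.2.1 j ≤ |R₀| + I * m := fun j => by
      have h5 : (r i).2.2.1 j + m ≤ ∑ k, ((r k).2.2.1 j + m) :=
        Finset.single_le_sum (f := fun k => (r k).2.2.1 j + m)
          (fun k _ => by linarith [hω k j]) (Finset.mem_univ i)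
      rw [Finset.sum_add_distrib] at h5
      simp only [Finset.sum_const, Finset.card_univ, Fintype.card_fin, nsmul_eq_mul] at h5
      have h6 : d.1 j ≤ R₀ := (le_abs_self _).trans
        ((norm_le_pi_norm d.1 j).trans ((norm_fst_le d).trans hd))
      have := h3 j
      linarith
    have hτ' : -(|R₀| + I * M) ≤ (r i).2.2.2 := by
      have h5 : M - (r i).2.2.2 ≤ ∑ k, (M - (r k).2.2.2) :=
        Finset.single_le_sum (f := fun k => M - (r k).2.2.2)
          (fun k _ => by linarith [hτ k]) (Finset.mem_univ i)
      rw [Finset.sum_sub_distrib] at h5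
      simp only [Finset.sum_const, Finset.card_univ, Fintype.card_fin, nsmul_eq_mul] at h5
      have h6 : -d.2 ≤ R₀ := (neg_le_abs _).trans ((norm_snd_le d).trans hd)
      linarith
    rw [Prod.norm_def, Prod.norm_def, Prod.norm_def]
    refine max_le ?_ (max_le ?_ (max_le ?_ ?_))
    · rw [Real.norm_of_nonneg (hl0 i)]
      linarith [hl1 i]
    · have h5 := (hb i).1
      nlinarith [hl0 i, hl1 i]
    · refine (pi_norm_le_iff_of_nonneg hB0).2 fun j => ?_
      rw [Real.norm_eq_abs, abs_le]
      constructor <;> linarith [hω i j, hω' j]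
    · rw [Real.norm_eq_abs, abs_le]
      constructor <;> linarith [hτ i]

lemma le_of_mem_mixSet (hU : ∀ i, IsAugmented (U i) R m M) {d : (Fin J → ℝ) × ℝ}
    (hd : d ∈ mixSet U) : d.2 ≤ M := by
  obtain ⟨r, h1, h2, -, h4⟩ := hd
  refine h4.trans ((Finset.sum_le_sum fun i _ => (pcone_bounds (hU i) (h1 i)).2.2).trans ?_)
  rw [← Finset.mul_sum, h2, mul_one]

lemma mem_mixSet_of_mem {i : Fin I} {q : (Fin n → ℝ) × (Fin J → ℝ) × ℝ} (hq : q ∈ U i)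
    {d : (Fin J → ℝ) × ℝ} (h1 : ∀ j, q.2.1 j ≤ d.1 j) (h2 : d.2 ≤ q.2.2) : d ∈ mixSet U := by
  have hs : ∀ k, k ≠ i → (Pi.single i (1, q) : Fin I → ℝ × (Fin n → ℝ) × (Fin J → ℝ) × ℝ) k = 0 :=
    fun k hk => by simp [hk]
  refine ⟨Pi.single i (1, q), fun k => ?_, ?_, fun j => ?_, ?_⟩
  · by_cases hk : k = i
    · subst hk
      simpa using mem_pcone_of_mem hq
    · rw [hs k hk]
      exact zero_mem_pcone
  · rw [Finset.sum_eq_single i (fun k _ hk => by rw [hs k hk]; rfl) (by simp)]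
    simp
  · rw [Finset.sum_eq_single i (fun k _ hk => by rw [hs k hk]; rfl) (by simp)]
    simpa using h1 j
  · rw [Finset.sum_eq_single i (fun k _ hk => by rw [hs k hk]; rfl) (by simp)]
    simpa using h2

/-- Strong duality between mixtures and affine majorants. -/
lemma exists_affine_bound (hR : 0 ≤ R) (hm : 0 ≤ m) (hM : 0 ≤ M)
    (hU : ∀ i, IsAugmented (U i) R m M) {μ : Fin J → ℝ} {v : ℝ} (hv : (μ, v) ∉ mixSet U) :
    ∃ (α : ℝ) (β : Fin J → ℝ), (∀ j, 0 ≤ β j) ∧ α + dotp μ β < v ∧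
      ∀ i, ∀ q ∈ U i, q.2.2 ≤ α + dotp q.2.1 β := by
  rcases isEmpty_or_nonempty (Fin I) with hI | ⟨⟨i₀⟩⟩
  · refine ⟨v - 1, 0, fun j => le_rfl, ?_, fun i => hI.elim i⟩
    rw [dotp_comm, dotp_zero]
    linarith
  obtain ⟨y, s, γ, hlt, hgt⟩ := exists_separation_prod (convex_mixSet hU)
    (isClosed_mixSet hR hm hM hU) hv
  obtain ⟨w, hw⟩ := exists_dotp y
  simp only [hw] at hlt hgt
  obtain ⟨q₀, hq₀⟩ := (hU i₀).nonempty
  have hs : s ≤ 0 := by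
    have : 0 ≤ -s := nonneg_of_forall_sub_mul_lt (a := dotp w q₀.2.1) (γ := γ) (t := -q₀.2.2)
      fun t ht => by
        have := hlt (q₀.2.1, -t) (mem_mixSet_of_mem hq₀ (fun j => le_rfl)
          (by simp only; linarith))
        simp only at this
        linarith
    linarith
  have hwn : ∀ j, w j ≤ 0 := by
    intro j
    have : 0 ≤ -w j := nonneg_of_forall_sub_mul_lt (a := dotp w q₀.2.1 - s * q₀.2.2) (γ := γ)
      (t := 0) fun t ht => by
        have h1 := hlt (q₀.2.1 + Pi.single j t, q₀.2.2) (mem_mixSet_of_mem hq₀ (fun k => by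
          by_cases hk : k = j
          · subst hk; simpa using ht
          · simp [hk]) le_rfl)
        have h2 : dotp w (Pi.single j t) = w j * t := by
          simp [dotp, Pi.single_apply]
        simp only at h1
        rw [dotp_comm w, dotp_add, dotp_comm _ w, dotp_comm _ w, h2] at h1
        linarith
    linarith
  have hmem : ∀ i, ∀ q ∈ U i, dotp w q.2.1 - s * q.2.2 < γ := fun i q hq =>
    hlt (q.2.1, q.2.2) (mem_mixSet_of_mem hq (fun j => le_rfl) le_rfl)
  rcases hs.eq_or_lt with rfl | hs
  · have hd : 0 < dotp w μ - γ := by linarith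
    set k := max 0 ((M - v + 1) / (dotp w μ - γ)) with hk
    have hk0 : 0 ≤ k := le_max_left _ _
    refine ⟨M + k * γ, -(k • w), fun j => ?_, ?_, fun i q hq => ?_⟩
    · have := mul_nonneg hk0 (neg_nonneg.2 (hwn j))
      simpa using this
    · have h1 : M - v + 1 ≤ k * (dotp w μ - γ) := by
        rw [← div_le_iff₀ hd]
        exact le_max_right _ _
      rw [dotp_comm, ← neg_smul, dotp_smul]
      linarith
    · rw [dotp_comm, ← neg_smul, dotp_smul]
      have h1 := hmem i q hq
      have h2 := (hU i).le q hq
      nlinarith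
  · have hs' : 0 < -s := by linarith
    have key : ∀ u, dotp u ((-s)⁻¹ • -w) = -((-s)⁻¹ * dotp w u) := fun u => by
      rw [dotp_comm, dotp_smul, ← neg_one_smul ℝ w, dotp_smul]
      ring
    refine ⟨(-s)⁻¹ * γ, (-s)⁻¹ • -w, fun j => ?_, ?_, fun i q hq => ?_⟩
    · exact mul_nonneg (inv_pos.2 hs').le (neg_nonneg.2 (hwn j))
    · rw [key]
      have h1 : (-s)⁻¹ * (γ - dotp w μ) < (-s)⁻¹ * (-s * v) := by
        have := inv_pos.2 hs'
        gcongr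
        linarith
      rw [inv_mul_cancel_left₀ hs'.ne'] at h1
      linarith
    · rw [key]
      have h1 : (-s)⁻¹ * (-s * q.2.2) ≤ (-s)⁻¹ * (γ - dotp w q.2.1) := by
        have := inv_pos.2 hs'
        have := hmem i q hq
        gcongr
        linarith
      rw [inv_mul_cancel_left₀ hs'.ne'] at h1
      linarith

end

section

variable {gi : Fin I → (Fin dz → ℝ) → EReal} {c : Fin L → (Fin dz → ℝ) → EReal}
  {h : Fin J → (Fin dz → ℝ) → EReal} {i : Fin I}

lemma mem_Uset_iff {q : (Fin dz → ℝ) × (Fin J → ℝ) × ℝ} :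
    q ∈ Uset gi c h i ↔ (∀ l, (q.1, (0 : ℝ)) ∈ epi (c l)) ∧ (∀ j, (q.1, q.2.1 j) ∈ epi (h j)) ∧
      (q.1, -q.2.2) ∈ epi fun z => -gi i z := by
  simp [Uset, epi]

lemma isClosed_Uset (hG : AssumptionG gi) (hC : AssumptionC c) (hH : AssumptionH h) :
    IsClosed (Uset gi c h i) := by
  have : Uset gi c h i = (⋂ l, (fun q => (q.1, (0 : ℝ))) ⁻¹' epi (c l)) ∩
      ((⋂ j, (fun q => (q.1, q.2.1 j)) ⁻¹' epi (h j)) ∩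
        (fun q => (q.1, -q.2.2)) ⁻¹' epi fun z => -gi i z) := by
    ext q
    simp only [mem_Uset_iff, Set.mem_inter_iff, Set.mem_iInter, Set.mem_preimage]
  rw [this]
  refine (isClosed_iInter fun l => (isClosed_epi (hC l).2.1).preimage (by fun_prop)).inter
    ((isClosed_iInter fun j => (isClosed_epi (hH j).2.1).preimage (by fun_prop)).inter
      ((isClosed_epi (hG i).2.1).preimage (by fun_prop)))

lemma convex_Uset (hG : AssumptionG gi) (hC : AssumptionC c) (hH : AssumptionH h) :
    Convex ℝ (Uset gi c h i) := by
  intro p hp q hq a b ha hb hab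
  rw [mem_Uset_iff] at *
  refine ⟨fun l => ?_, fun j => ?_, ?_⟩
  · have : Convex ℝ (epi (c l)) := (hC l).2.2
    simpa using this (hp.1 l) (hq.1 l) ha hb hab
  · have : Convex ℝ (epi (h j)) := (hH j).2.2
    simpa using this (hp.2.1 j) (hq.2.1 j) ha hb hab
  · have : Convex ℝ (epi fun z => -gi i z) := (hG i).2.2
    have := this hp.2.2 hq.2.2 ha hb hab
    simp only [Prod.smul_mk, Prod.mk_add_mk, smul_eq_mul, mul_neg, ← neg_add] at this
    exact this

lemma mem_Uset_of_mem_SbarI (hG : AssumptionG gi) (hH : AssumptionH h) {z : Fin dz → ℝ}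
    (hz : z ∈ SbarI gi c h i) : (z, (fun j => (h j z).toReal), (gi i z).toReal) ∈ Uset gi c h i := by
  refine ⟨hz.1, fun j => ?_, ?_⟩
  · rw [EReal.coe_toReal (hz.2.1 j).ne ((hH j).1.1 z)]
  · rw [EReal.coe_toReal (fun h => (hG i).1.1 z (by simp [h])) hz.2.2.ne']

lemma mem_SbarI_of_mem_Uset {q : (Fin dz → ℝ) × (Fin J → ℝ) × ℝ} (hq : q ∈ Uset gi c h i) :
    q.1 ∈ SbarI gi c h i :=
  ⟨hq.1, fun j => (hq.2.1 j).trans_lt (EReal.coe_lt_top _), (EReal.bot_lt_coe _).trans_le hq.2.2⟩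

/-- The augmented support sets of a bounded support set are uniformly bounded up to `upDirs`. -/
lemma exists_isAugmented_Uset (hG : AssumptionG gi) (hC : AssumptionC c) (hH : AssumptionH h)
    (hS : AssumptionS gi c h) (hbd : Bornology.IsBounded (Sset c)) :
    ∃ R m M : ℝ, 0 ≤ R ∧ 0 ≤ m ∧ 0 ≤ M ∧ ∀ i, IsAugmented (Uset gi c h i) R m M := by
  obtain ⟨R, hR⟩ := hbd.exists_norm_le
  choose m hm0 hm using fun j => exists_lower_bound_of_isBounded (hH j).1 (hH j).2.1 hbd
  choose M hM0 hM using fun i => exists_lower_bound_of_isBounded (hG i).1 (hG i).2.1 hbd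
  refine ⟨max R 0, ∑ j, m j, ∑ i, M i, le_max_right _ _, Finset.sum_nonneg fun j _ => hm0 j,
    Finset.sum_nonneg fun i _ => hM0 i, fun i => ⟨isClosed_Uset hG hC hH, convex_Uset hG hC hH,
    ?_, ?_, ?_, ?_, ?_⟩⟩
  · obtain ⟨z, hz⟩ := hS i
    exact ⟨_, mem_Uset_of_mem_SbarI hG hH hz⟩
  · rintro q ⟨h1, h2, h3⟩ d ⟨k1, k2, k3⟩
    refine ⟨?_, fun j => ?_, ?_⟩
    · simpa [k1] using h1
    · have := h2 j
      simp only [Prod.fst_add, k1, add_zero, Prod.snd_add, Pi.add_apply]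
      exact this.trans (EReal.coe_le_coe_iff.2 (by linarith [k2 j]))
    · simp only [Prod.fst_add, k1, add_zero, Prod.snd_add]
      exact (EReal.coe_le_coe_iff.2 (by linarith)).trans h3
  · exact fun q hq => (hR _ hq.1).trans (le_max_left _ _)
  · intro q hq j
    have h1 := EReal.coe_le_coe_iff.1 ((hm j _ hq.1).trans (hq.2.1 j))
    have h2 := Finset.single_le_sum (fun k _ => hm0 k) (Finset.mem_univ j)
    linarith
  · intro q hq
    have h1 := (hM i _ hq.1).trans (EReal.neg_le_neg_iff.2 hq.2.2)
    rw [← EReal.coe_neg, EReal.coe_le_coe_iff] at h1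
    have h2 := Finset.single_le_sum (fun k _ => hM0 k) (Finset.mem_univ i)
    linarith

/-- `dom f*` of a proper closed convex function `f` is nonempty. -/
lemma edom_conjFn_nonempty {n : ℕ} {f : (Fin n → ℝ) → EReal} (hp : ProperFn f) (hf : ClosedFn f)
    (hc : ConvexFn f) : (edom (conjFn f)).Nonempty := by
  by_contra hne
  rw [Set.not_nonempty_iff_eq_empty] at hne
  have htop : ∀ w, conjFn f w = ⊤ := fun w => by
    by_contra hw
    exact Set.eq_empty_iff_forall_notMem.1 hne w (lt_top_iff_ne_top.2 hw)
  obtain ⟨x, -⟩ := hp.2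
  have h1 := le_biconj hp hf hc x
  have h2 : conjFn (conjFn f) x = ⊥ := by
    simp [conjFn.eq_1 (conjFn f), htop]
  exact hp.1 x (le_bot_iff.1 (h2 ▸ h1))

lemma suppFn_zero_of_nonempty {n : ℕ} {X : Set (Fin n → ℝ)} (hX : X.Nonempty) :
    suppFn X 0 = 0 := by
  have : ∀ x : Fin n → ℝ, dotp x 0 = 0 := fun x => by rw [dotp_comm, dotp_zero]
  simp only [suppFn, this, EReal.coe_zero]
  exact biSup_const hX

lemma dotp_le_of_suppFn_le {n : ℕ} {X : Set (Fin n → ℝ)} {w x : Fin n → ℝ} {a : ℝ}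
    (hX : suppFn X w ≤ a) (hx : x ∈ X) : dotp x w ≤ a :=
  EReal.coe_le_coe_iff.1 ((le_iSup₂ (f := fun x _ => ((dotp x w : ℝ) : EReal)) x hx).trans hX)

lemma suppFn_le {n : ℕ} {X : Set (Fin n → ℝ)} {w : Fin n → ℝ} {a : ℝ}
    (hX : ∀ x ∈ X, dotp x w ≤ a) : suppFn X w ≤ a :=
  iSup₂_le fun x hx => EReal.coe_le_coe_iff.2 (hX x hx)

/-- A direction in which the support function of `dom f*` is nonpositive is a direction of
recession of the closed convex function `f`. -/
lemma apply_add_smul_le_of_suppFn_nonpos {n : ℕ} {f : (Fin n → ℝ) → EReal} (hp : ProperFn f)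
    (hf : ClosedFn f) (hc : ConvexFn f) {w : Fin n → ℝ} (hw : suppFn (edom (conjFn f)) w ≤ 0)
    (z : Fin n → ℝ) {a : ℝ} (ha : 0 ≤ a) : f (z + a • w) ≤ f z := by
  refine (le_biconj hp hf hc _).trans (iSup_le fun y => ?_)
  by_cases hy : y ∈ edom (conjFn f)
  · have h1 : dotp y w ≤ 0 := dotp_le_of_suppFn_le (by simpa using hw) hy
    have h2 : dotp (z + a • w) y ≤ dotp y z := by
      rw [dotp_comm, dotp_comm y z, dotp_comm y, dotp_add, dotp_smul, dotp_comm z, dotp_comm w]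
      have := mul_nonpos_of_nonneg_of_nonpos ha h1
      linarith
    rcases eq_or_ne (f z) ⊤ with ht | ht
    · rw [ht]
      exact le_top
    have h3 := le_conjFn f y z (t := (f z).toReal) (EReal.coe_toReal ht (hp.1 z)).ge
    refine (EReal.sub_le_sub (EReal.coe_le_coe_iff.2 h2) h3).trans ?_
    rw [← EReal.coe_sub, ← EReal.coe_toReal ht (hp.1 z), EReal.coe_le_coe_iff, EReal.toReal_coe]
    linarith
  · have : conjFn f y = ⊤ := by
      simpa [edom] using hy
    simp [this]

end

lemma coe_mul_le_coe_iff {a b : ℝ} (ha : 0 < a) {x : EReal} :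
    (a : EReal) * x ≤ (b : EReal) ↔ x ≤ ((a⁻¹ * b : ℝ) : EReal) := by
  induction x with
  | bot => simp [EReal.coe_mul_bot_of_pos ha]
  | top => simp [EReal.coe_mul_top_of_pos ha, -EReal.coe_mul]
  | coe x =>
    rw [← EReal.coe_mul, EReal.coe_le_coe_iff, EReal.coe_le_coe_iff, le_inv_mul_iff₀ ha]

lemma coe_le_coe_mul_iff {a b : ℝ} (ha : 0 < a) {x : EReal} :
    (b : EReal) ≤ (a : EReal) * x ↔ ((a⁻¹ * b : ℝ) : EReal) ≤ x := by
  induction x with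
  | bot => simp [EReal.coe_mul_bot_of_pos ha, -EReal.coe_mul]
  | top => simp [EReal.coe_mul_top_of_pos ha]
  | coe x =>
    rw [← EReal.coe_mul, EReal.coe_le_coe_iff, EReal.coe_le_coe_iff, inv_mul_le_iff₀ ha]

/-- A direction in which every point of a nonempty bounded set stays inside is zero. -/
lemma eq_zero_of_forall_add_smul_mem {n : ℕ} {S : Set (Fin n → ℝ)} (hbd : Bornology.IsBounded S)
    {z w : Fin n → ℝ} (hz : ∀ a : ℝ, 0 ≤ a → z + a • w ∈ S) : w = 0 := by
  obtain ⟨R, hR⟩ := hbd.exists_norm_le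
  by_contra hw
  have hw' : 0 < ‖w‖ := norm_pos_iff.2 hw
  have hR0 : 0 ≤ R := (norm_nonneg _).trans (hR _ (hz 0 le_rfl))
  have ha : 0 ≤ (R + ‖z‖ + 1) / ‖w‖ := by positivity
  have h1 := hR _ (hz _ ha)
  have h2 : ‖((R + ‖z‖ + 1) / ‖w‖) • w‖ ≤ ‖z + ((R + ‖z‖ + 1) / ‖w‖) • w‖ + ‖z‖ := by
    simpa using norm_sub_le (z + ((R + ‖z‖ + 1) / ‖w‖) • w) z
  rw [norm_smul, Real.norm_of_nonneg ha, div_mul_cancel₀ _ hw'.ne'] at h2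
  linarith

section

variable {gi : Fin I → (Fin dz → ℝ) → EReal} {c : Fin L → (Fin dz → ℝ) → EReal}
  {h : Fin J → (Fin dz → ℝ) → EReal} {μ : Fin J → ℝ}

/-- The perspective constraints of (AD-B') describe the closed conic hull of `U_i`. -/
lemma adbpCon_iff_mem_pcone (hG : AssumptionG gi) (hC : AssumptionC c) (hH : AssumptionH h)
    (hSne : (Sset c).Nonempty) (hbd : Bornology.IsBounded (Sset c)) (i : Fin I)
    (r : (Fin I → ℝ) × (Fin I → ℝ) × (Fin I → Fin J → ℝ) × (Fin I → Fin dz → ℝ)) :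
    (0 ≤ r.2.1 i ∧ (∀ l, adbpConC (J := J) c i l r ≤ 0) ∧
      (∀ j, adbpConH (L := L) h i j r ≤ 0) ∧ adbpConG (J := J) (L := L) gi i r ≤ 0) ↔
    (r.2.1 i, r.2.2.2 i, r.2.2.1 i, r.1 i) ∈ pcone (Uset gi c h i) := by
  refine and_congr_right fun h0 => ?_
  simp only [adbpConC, adbpConH, adbpConG, EReal.sub_nonpos]
  rcases h0.eq_or_lt with hl | hl
  · simp only [persp, cpersp, ← hl, lt_irrefl, if_false, false_imp_iff, true_and, true_imp_iff,
      upDirs, Set.mem_ofPred_eq]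
    constructor
    · rintro ⟨h1, h2, h3⟩
      have hv : r.2.2.2 i = 0 := by
        obtain ⟨z, hz⟩ := hSne
        refine eq_zero_of_forall_add_smul_mem hbd (z := z) fun a ha l => ?_
        exact (apply_add_smul_le_of_suppFn_nonpos (hC l).1 (hC l).2.1 (hC l).2.2 (h1 l) z ha).trans
          (hz l)
      refine ⟨hv, fun j => ?_, ?_⟩
      · have := h2 j
        rw [hv, suppFn_zero_of_nonempty (edom_conjFn_nonempty (hH j).1 (hH j).2.1 (hH j).2.2)]
          at this
        exact_mod_cast this
      · rw [hv, suppFn_zero_of_nonempty (edom_conjFn_nonempty (hG i).1 (hG i).2.1 (hG i).2.2),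
          neg_zero] at h3
        exact_mod_cast h3
    · rintro ⟨h1, h2, h3⟩
      have hs : ∀ X : Set (Fin dz → ℝ), suppFn X 0 ≤ 0 := fun X => by
        refine (suppFn_le (a := 0) fun x _ => ?_).trans_eq EReal.coe_zero
        rw [dotp_comm, dotp_zero]
      rw [h1]
      refine ⟨fun l => hs _, fun j => (hs _).trans (by exact_mod_cast h2 j), ?_⟩
      refine le_trans ?_ (EReal.neg_le_neg_iff.2 (hs _))
      rw [neg_zero]
      exact_mod_cast h3
  · simp only [persp, cpersp, hl, if_true, true_imp_iff, hl.ne', false_imp_iff, and_true,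
      coe_mul_le_coe_iff hl, coe_le_coe_mul_iff hl]
    simp only [Uset, Set.mem_ofPred_eq, Prod.smul_mk, Pi.smul_apply, smul_eq_mul]
    refine and_congr (forall_congr' fun l => ?_) Iff.rfl
    rw [← EReal.coe_zero, coe_mul_le_coe_iff hl, mul_zero]

lemma mem_adbpFeas_iff (hG : AssumptionG gi) (hC : AssumptionC c) (hH : AssumptionH h)
    (hSne : (Sset c).Nonempty) (hbd : Bornology.IsBounded (Sset c))
    {r : (Fin I → ℝ) × (Fin I → ℝ) × (Fin I → Fin J → ℝ) × (Fin I → Fin dz → ℝ)} :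
    r ∈ adbpFeas gi c h μ ↔
      (∀ i, (r.2.1 i, r.2.2.2 i, r.2.2.1 i, r.1 i) ∈ pcone (Uset gi c h i)) ∧
      ∑ i, r.2.1 i = 1 ∧ ∀ j, ∑ i, r.2.2.1 i j ≤ μ j := by
  simp only [← adbpCon_iff_mem_pcone hG hC hH hSne hbd, forall_and, adbpFeas, Set.mem_ofPred_eq]
  tauto

lemma mem_mixSet_Uset_iff (hG : AssumptionG gi) (hC : AssumptionC c) (hH : AssumptionH h)
    (hSne : (Sset c).Nonempty) (hbd : Bornology.IsBounded (Sset c)) {t : ℝ} :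
    (μ, t) ∈ mixSet (fun i => Uset gi c h i) ↔ ∃ r ∈ adbpFeas gi c h μ, t ≤ ∑ i, r.1 i := by
  constructor
  · rintro ⟨r, h1, h2, h3, h4⟩
    exact ⟨(fun i => (r i).2.2.2, fun i => (r i).1, fun i => (r i).2.2.1, fun i => (r i).2.1),
      (mem_adbpFeas_iff hG hC hH hSne hbd).2 ⟨h1, h2, h3⟩, h4⟩
  · rintro ⟨r, hr, ht⟩
    obtain ⟨h1, h2, h3⟩ := (mem_adbpFeas_iff hG hC hH hSne hbd).1 hr
    exact ⟨fun i => (r.2.1 i, r.2.2.2 i, r.2.2.1 i, r.1 i), h1, h2, h3, ht⟩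

lemma coe_le_adbpVal (hG : AssumptionG gi) (hC : AssumptionC c)
    (hH : AssumptionH h) (hSne : (Sset c).Nonempty)
    (hbd : Bornology.IsBounded (Sset c)) {t : ℝ} (ht : (μ, t) ∈ mixSet fun i => Uset gi c h i) :
    (t : EReal) ≤ adbpVal gi c h μ := by
  obtain ⟨r, hr, hrt⟩ := (mem_mixSet_Uset_iff hG hC hH hSne hbd).1 ht
  exact (EReal.coe_le_coe_iff.2 hrt).trans
    (le_iSup₂ (f := fun r (_ : r ∈ adbpFeas gi c h μ) => ((∑ i, r.1 i : ℝ) : EReal)) r hr)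

lemma adbpSolvable_of_isBounded (hG : AssumptionG gi) (hC : AssumptionC c)
    (hH : AssumptionH h) (hS : AssumptionS gi c h) (hSne : (Sset c).Nonempty)
    (hbd : Bornology.IsBounded (Sset c)) : adbpSolvable gi c h μ := by
  refine (Set.eq_empty_or_nonempty _).imp_right fun ⟨r₀, hr₀⟩ => ?_
  obtain ⟨R, m, M, hR, hm, hM, hU⟩ := exists_isAugmented_Uset hG hC hH hS hbd
  set T : Set ℝ := {t | (μ, t) ∈ mixSet fun i => Uset gi c h i}
  have hT : IsClosed T := (isClosed_mixSet hR hm hM hU).preimage (by fun_prop)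
  have hne : T.Nonempty := ⟨_, (mem_mixSet_Uset_iff hG hC hH hSne hbd).2 ⟨r₀, hr₀, le_rfl⟩⟩
  have hbdd : BddAbove T := ⟨M, fun t ht => le_of_mem_mixSet hU ht⟩
  obtain ⟨r, hr, hle⟩ := (mem_mixSet_Uset_iff hG hC hH hSne hbd).1 (hT.csSup_mem hne hbdd)
  refine ⟨r, hr, le_antisymm (le_iSup₂ (f := fun r (_ : r ∈ adbpFeas gi c h μ) =>
    ((∑ i, r.1 i : ℝ) : EReal)) r hr) (iSup₂_le fun s hs => EReal.coe_le_coe_iff.2 ?_)⟩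
  exact (le_csSup hbdd ((mem_mixSet_Uset_iff hG hC hH hSne hbd).2 ⟨s, hs, le_rfl⟩)).trans hle

/-- Feasible solutions of (AD-B') yield at least as good solutions of (AD-B). -/
lemma exists_mem_adbFeas (hG : AssumptionG gi) (hC : AssumptionC c)
    (hH : AssumptionH h) (hS : AssumptionS gi c h) (hSne : (Sset c).Nonempty)
    (hbd : Bornology.IsBounded (Sset c))
    {r : (Fin I → ℝ) × (Fin I → ℝ) × (Fin I → Fin J → ℝ) × (Fin I → Fin dz → ℝ)}
    (hr : r ∈ adbpFeas gi c h μ) :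
    ∃ q : Fin I → (Fin dz → ℝ) × (Fin J → ℝ) × ℝ, (q, r.2.1) ∈ adbFeas gi c h μ ∧
      (∀ i, 0 < r.2.1 i → (q i).1 = (r.2.1 i)⁻¹ • r.2.2.2 i) ∧
      ∑ i, r.1 i ≤ ∑ i, r.2.1 i * (q i).2.2 := by
  obtain ⟨h1, h2, h3⟩ := (mem_adbpFeas_iff hG hC hH hSne hbd).1 hr
  have hq : ∀ i, ∃ q ∈ Uset gi c h i, (0 < r.2.1 i → q.1 = (r.2.1 i)⁻¹ • r.2.2.2 i) ∧
      (∀ j, r.2.1 i * q.2.1 j ≤ r.2.2.1 i j) ∧ r.1 i ≤ r.2.1 i * q.2.2 := by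
    intro i
    obtain ⟨k1, k2, k3⟩ := h1 i
    rcases k1.eq_or_lt with hl | hl
    · obtain ⟨z, hz⟩ := hS i
      obtain ⟨-, k4, k5⟩ := k3 hl.symm
      simp only at hl
      refine ⟨_, mem_Uset_of_mem_SbarI hG hH hz, fun hl' => absurd hl hl'.ne, fun j => ?_, ?_⟩
      · simpa [← hl] using k4 j
      · simpa [← hl] using k5
    · refine ⟨_, k2 hl, fun _ => rfl, fun j => ?_, ?_⟩
      · simp [mul_inv_cancel_left₀ (ne_of_gt hl : r.2.1 i ≠ 0)]
      · simp [mul_inv_cancel_left₀ (ne_of_gt hl : r.2.1 i ≠ 0)]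
  choose q hqU hq1 hq2 hq3 using hq
  exact ⟨q, ⟨hqU, fun i => (h1 i).1, h2, fun j =>
    (Finset.sum_le_sum fun i _ => hq2 i j).trans (h3 j)⟩, hq1, Finset.sum_le_sum fun i _ => hq3 i⟩

lemma adbpVal_le_adbVal (hG : AssumptionG gi) (hC : AssumptionC c)
    (hH : AssumptionH h) (hS : AssumptionS gi c h) (hSne : (Sset c).Nonempty)
    (hbd : Bornology.IsBounded (Sset c)) : adbpVal gi c h μ ≤ adbVal gi c h μ := by
  refine iSup₂_le fun r hr => ?_
  obtain ⟨q, hq, -, hle⟩ := exists_mem_adbFeas hG hC hH hS hSne hbd hr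
  exact (EReal.coe_le_coe_iff.2 hle).trans (le_iSup₂ (f := fun p (_ : p ∈ adbFeas gi c h μ) =>
    ((∑ i, p.2 i * (p.1 i).2.2 : ℝ) : EReal)) (q, r.2.1) hq)

end

lemma ereal_coe_sum {ι : Type*} (s : Finset ι) (f : ι → ℝ) :
    ((∑ i ∈ s, f i : ℝ) : EReal) = ∑ i ∈ s, (f i : EReal) := by
  induction s using Finset.induction_on with
  | empty => simp
  | insert a s ha ih => rw [Finset.sum_insert ha, Finset.sum_insert ha, EReal.coe_add, ih]

section

variable {n : ℕ} {f : (Fin n → ℝ) → EReal} {y : Fin n → ℝ} {ν b : ℝ}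

lemma persp_conjFn_le (hp : ProperFn f) (hf : ClosedFn f) (hc : ConvexFn f) (hν : 0 ≤ ν)
    (hb : ∀ p ∈ epi f, dotp y p.1 - ν * p.2 ≤ b) : persp (conjFn f) y ν ≤ b := by
  rcases hν.eq_or_lt with rfl | hν
  · rw [persp, if_neg (lt_irrefl _)]
    refine suppFn_le fun x hx => ?_
    have hx' : f x < ⊤ := (le_biconj hp hf hc x).trans_lt hx
    have := hb (x, (f x).toReal) (EReal.coe_toReal hx'.ne (hp.1 x)).ge
    rw [dotp_comm]
    simpa using this
  · rw [persp, if_pos hν, coe_mul_le_coe_iff hν]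
    refine conjFn_le hp.1 fun p hpe => ?_
    rw [dotp_smul, le_inv_mul_iff₀ hν, mul_sub, mul_inv_cancel_left₀ hν.ne']
    exact hb p hpe

lemma le_persp_conjFn (hν : 0 ≤ ν) {z : Fin n → ℝ} {t : ℝ} (hz : f z ≤ t) :
    ((dotp y z - ν * t : ℝ) : EReal) ≤ persp (conjFn f) y ν := by
  rcases hν.eq_or_lt with rfl | hν
  · rw [persp, if_neg (lt_irrefl _), zero_mul, sub_zero, dotp_comm]
    have hmem : z ∈ edom (conjFn (conjFn f)) := by
      refine lt_of_le_of_lt (iSup_le fun w => ?_) (EReal.coe_lt_top t)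
      refine (EReal.sub_le_sub le_rfl (le_conjFn f w z hz)).trans_eq ?_
      rw [← EReal.coe_sub, dotp_comm z w, sub_sub_cancel]
    exact le_iSup₂ (f := fun x (_ : x ∈ edom (conjFn (conjFn f))) => ((dotp x y : ℝ) : EReal))
      z hmem
  · rw [persp, if_pos hν, coe_le_coe_mul_iff hν, mul_sub, inv_mul_cancel_left₀ hν.ne', ← dotp_smul]
    exact le_conjFn f _ z hz

end

section

variable {gi : Fin I → (Fin dz → ℝ) → EReal} {c : Fin L → (Fin dz → ℝ) → EReal}
  {h : Fin J → (Fin dz → ℝ) → EReal} {μ : Fin J → ℝ}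

lemma apwVal_le_apwpVal : apwVal gi c h μ ≤ apwpVal gi c h μ := by
  refine le_iInf₂ fun q hq => ?_
  obtain ⟨h1, h2, h3, h4⟩ := hq
  refine iInf₂_le (f := fun (p : ℝ × (Fin J → ℝ)) (_ : p ∈ apwFeas gi c h) =>
    ((p.1 + dotp μ p.2 : ℝ) : EReal)) (q.1, q.2.1) ⟨h3, fun i p hp => ?_⟩
  have h5 := EReal.sub_nonpos.1 (h1 i)
  have h6 : ((dotp (q.2.2.1 i) p.1 - -p.2.2 + ∑ j, (dotp (q.2.2.2.1 i j) p.1 - q.2.1 j * p.2.1 j) +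
      ∑ l, (dotp (q.2.2.2.2.1 i l) p.1 - q.2.2.2.2.2 i l * 0) : ℝ) : EReal) ≤ (q.1 : EReal) := by
    refine le_trans ?_ h5
    rw [EReal.coe_add, EReal.coe_add, ereal_coe_sum, ereal_coe_sum]
    refine add_le_add (add_le_add (le_conjFn _ _ _ ?_) (Finset.sum_le_sum fun j _ => ?_))
      (Finset.sum_le_sum fun l _ => ?_)
    · simpa using hp.2.2
    · exact le_persp_conjFn (h3 j) (hp.2.1 j)
    · exact le_persp_conjFn (h4 i l) (by simpa using hp.1 l)
  have h7 := EReal.coe_le_coe_iff.1 h6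
  have h8 := congrArg (fun y => dotp y p.1) (h2 i)
  simp only [dotp_add, dotp_sum, dotp_zero] at h8
  simp only [Finset.sum_sub_distrib, mul_zero, sub_zero] at h7
  have h9 : dotp p.2.1 q.2.1 = ∑ j, q.2.1 j * p.2.1 j := dotp_comm _ _
  rw [h9]
  linarith

/-- Optimal multipliers for the inner maximization problems up to `δ`. -/
lemma exists_mem_apwpFeas (hG : AssumptionG gi) (hC : AssumptionC c) (hH : AssumptionH h)
    (hS : AssumptionS gi c h) (hbd : Bornology.IsBounded (Sset c)) {α : ℝ} {β : Fin J → ℝ}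
    (hβ : ∀ j, 0 < β j) (hα : ∀ i, ∀ q ∈ Uset gi c h i, q.2.2 ≤ α + dotp q.2.1 β) {δ : ℝ}
    (hδ : 0 < δ) : ∃ q ∈ apwpFeas gi c h, q.1 = α + δ ∧ q.2.1 = β := by
  have key : ∀ i, ∃ (y₀ : Fin dz → ℝ) (y : Fin J → Fin dz → ℝ) (y' : Fin L → Fin dz → ℝ)
      (ν : Fin L → ℝ), y₀ + ∑ j, y j + ∑ l, y' l = 0 ∧ (∀ l, 0 ≤ ν l) ∧
      conjFn (fun z => -gi i z) y₀ + ∑ j, persp (conjFn (h j)) (y j) (β j) +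
        ∑ l, persp (conjFn (c l)) (y' l) (ν l) ≤ ((α + δ : ℝ) : EReal) := by
    intro i
    obtain ⟨z₀, hz₀⟩ := hS i
    have hz₀ := mem_Uset_iff.1 (mem_Uset_of_mem_SbarI hG hH hz₀)
    let F : Option (Fin J) → (Fin dz → ℝ) → EReal := fun k => k.elim (fun z => -gi i z) h
    have hF : ∀ k, ProperFn (F k) ∧ ClosedFn (F k) ∧ ConvexFn (F k) := fun k =>
      k.rec (hG i) hH
    obtain ⟨y, y', ν, b, b', hsum, hν, hb, hb', hle⟩ := exists_multipliers
      (fun k => epi (F k)) (fun l => epi (c l)) (fun k => k.elim 1 β)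
      (fun k => k.rec one_pos hβ) (fun k => isClosed_epi (hF k).2.1) (fun k => (hF k).2.2)
      (fun l => isClosed_epi (hC l).2.1) (fun l => (hC l).2.2)
      (fun l p hp t ht => le_trans hp (EReal.coe_le_coe_iff.2 ht))
      (fun k R => by
        obtain ⟨m, -, hm⟩ := exists_lower_bound_of_isBounded (hF k).1 (hF k).2.1
          (Metric.isBounded_closedBall (x := (0 : Fin dz → ℝ)) (r := R))
        exact ⟨m, fun p hp hpR => EReal.coe_le_coe_iff.1
          ((hm p.1 (by simpa using hpR)).trans hp)⟩)
      z₀ (fun k => k.elim (-(gi i z₀).toReal) fun j => (h j z₀).toReal)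
      (fun k => k.rec hz₀.2.2 hz₀.2.1) hz₀.1 (by simpa [epi, Sset] using hbd) α
      (fun z t ht hz => by
        have := hα i (z, fun j => t (some j), -t none)
          (mem_Uset_iff.2 ⟨hz, fun j => ht (some j), by
            rw [neg_neg]
            exact ht none⟩)
        rw [dotp_comm] at this
        simp only [dotp] at this
        simp only [Fintype.sum_option, Option.elim]
        linarith) hδ
    rw [Fintype.sum_option] at hsum hle
    refine ⟨y none, fun j => y (some j), y', ν, hsum, hν, ?_⟩
    refine le_trans ?_ (EReal.coe_le_coe_iff.2 hle)
    rw [EReal.coe_add, EReal.coe_add, ereal_coe_sum, ereal_coe_sum]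
    refine add_le_add (add_le_add (conjFn_le (hG i).1.1 ?_) (Finset.sum_le_sum fun j _ => ?_))
      (Finset.sum_le_sum fun l _ => ?_)
    · exact fun p hp => by simpa using hb none p hp
    · exact persp_conjFn_le (hH j).1 (hH j).2.1 (hH j).2.2 (hβ j).le (hb (some j))
    · exact persp_conjFn_le (hC l).1 (hC l).2.1 (hC l).2.2 (hν l) (hb' l)
  choose y₀ y y' ν h1 h2 h3 using key
  exact ⟨(α + δ, β, y₀, y, y', ν), ⟨fun i => EReal.sub_nonpos.2 (h3 i), h1, fun j => (hβ j).le, h2⟩,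
    rfl, rfl⟩

lemma apwpVal_le_adbpVal (hG : AssumptionG gi) (hC : AssumptionC c) (hH : AssumptionH h)
    (hS : AssumptionS gi c h) (hSne : (Sset c).Nonempty) (hbd : Bornology.IsBounded (Sset c)) :
    apwpVal gi c h μ ≤ adbpVal gi c h μ := by
  refine EReal.le_of_forall_lt_iff_le.1 fun v hv => ?_
  obtain ⟨R, m, M, hR, hm, hM, hU⟩ := exists_isAugmented_Uset hG hC hH hS hbd
  obtain ⟨α, β, hβ, hlt, hα⟩ := exists_affine_bound hR hm hM hU (μ := μ) (v := v) fun hmem =>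
    absurd (coe_le_adbpVal hG hC hH hSne hbd hmem) (not_le_of_gt hv)
  set Δ := v - (α + dotp μ β) with hΔ
  have hΔ0 : 0 < Δ := sub_pos.2 hlt
  set C := |J * m + ∑ j, μ j| + 1 with hC'
  have hC0 : 0 < C := by positivity
  set ε := Δ / (2 * C) with hε
  have hε0 : 0 < ε := by positivity
  have hεC : ε * C = Δ / 2 := by
    rw [hε]
    field_simp
  obtain ⟨q, hq, hq1, hq2⟩ := exists_mem_apwpFeas hG hC hH hS hbd (α := α + ε * (J * m))
    (β := fun j => β j + ε) (fun j => add_pos_of_nonneg_of_pos (hβ j) hε0) (fun i q hq => by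
      have h1 := hα i q hq
      have h2 : dotp q.2.1 (fun j => β j + ε) = dotp q.2.1 β + ε * ∑ j, q.2.1 j := by
        simp only [dotp, mul_add, Finset.sum_add_distrib, Finset.mul_sum]
        simp only [mul_comm ε]
      have h3 : -(J * m) ≤ ∑ j, q.2.1 j := by
        have := Finset.sum_le_sum fun j (_ : j ∈ Finset.univ) => (hU i).neg_le q hq j
        simpa using this
      have h4 := mul_le_mul_of_nonneg_left h3 hε0.le
      rw [h2]
      linarith) (δ := Δ / 4) (by positivity)
  refine (iInf₂_le (f := fun (q : ℝ × (Fin J → ℝ) × (Fin I → Fin dz → ℝ) ×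
    (Fin I → Fin J → Fin dz → ℝ) × (Fin I → Fin L → Fin dz → ℝ) × (Fin I → Fin L → ℝ))
    (_ : q ∈ apwpFeas gi c h) => ((q.1 + dotp μ q.2.1 : ℝ) : EReal)) q hq).trans ?_
  rw [EReal.coe_le_coe_iff, hq1, hq2]
  have h2 : dotp μ (fun j => β j + ε) = dotp μ β + ε * ∑ j, μ j := by
    simp only [dotp, mul_add, Finset.sum_add_distrib, Finset.mul_sum]
    simp only [mul_comm ε]
  have h3 : ε * (J * m + ∑ j, μ j) ≤ ε * C :=
    mul_le_mul_of_nonneg_left ((le_abs_self _).trans (le_add_of_nonneg_right zero_le_one)) hε0.le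
  rw [h2]
  linarith

end

section

variable {n : ℕ}

lemma epos_coe (x : ℝ) : epos (x : EReal) = ENNReal.ofReal x := by
  simp [epos]

lemma epos_neg_coe (x : ℝ) : epos (-(x : EReal)) = ENNReal.ofReal (-x) := by
  rw [← EReal.coe_neg, epos_coe]

lemma epos_le_of_le {x : EReal} {a : ℝ} (h : x ≤ a) : epos x ≤ ENNReal.ofReal a := by
  induction x with
  | bot => simp [epos]
  | top => exact absurd (top_le_iff.1 h) (EReal.coe_ne_top a)
  | coe x =>
    rw [epos_coe]
    exact ENNReal.ofReal_le_ofReal (EReal.coe_le_coe_iff.1 h)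

lemma measurable_epos : Measurable epos :=
  Measurable.ite (measurableSet_singleton _) measurable_const
    (ENNReal.measurable_ofReal.comp measurable_ereal_toReal)

/-- An extended-real-valued function whose positive and negative parts both have finite
expectation is almost surely finite, integrable, and `lowExp` is its Bochner integral. -/
lemma lowExp_eq_integral {P : Measure (Fin n → ℝ)} {f : (Fin n → ℝ) → EReal} (hf : Measurable f)
    (h1 : ∫⁻ z, epos (f z) ∂P ≠ ⊤) (h2 : ∫⁻ z, epos (-f z) ∂P ≠ ⊤) :
    (∀ᵐ z ∂P, f z ≠ ⊤ ∧ f z ≠ ⊥) ∧ Integrable (fun z => (f z).toReal) P ∧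
      lowExp P f = ((∫ z, (f z).toReal ∂P : ℝ) : EReal) := by
  have hfin : ∀ᵐ z ∂P, f z ≠ ⊤ ∧ f z ≠ ⊥ := by
    filter_upwards [ae_lt_top (measurable_epos.comp hf) h1,
      ae_lt_top (measurable_epos.comp hf.neg) h2] with z hz1 hz2
    exact ⟨fun h => by simp [h, epos] at hz1, fun h => by simp [h, epos] at hz2⟩
  have e1 : (fun z => epos (f z)) =ᵐ[P] fun z => ENNReal.ofReal (f z).toReal := by
    filter_upwards [hfin] with z hz
    rw [← epos_coe, EReal.coe_toReal hz.1 hz.2]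
  have e2 : (fun z => epos (-f z)) =ᵐ[P] fun z => ENNReal.ofReal (-(f z).toReal) := by
    filter_upwards [hfin] with z hz
    rw [← epos_neg_coe, EReal.coe_toReal hz.1 hz.2]
  rw [lintegral_congr_ae e1] at h1
  rw [lintegral_congr_ae e2] at h2
  have hm : Measurable fun z => (f z).toReal := measurable_ereal_toReal.comp hf
  have hint : Integrable (fun z => (f z).toReal) P := by
    refine ⟨hm.aestronglyMeasurable, ?_⟩
    rw [hasFiniteIntegral_iff_enorm]
    refine (lintegral_mono fun z => ?_).trans_lt
      ((lintegral_add_left hm.ennreal_ofReal _).trans_lt (ENNReal.add_lt_top.2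
        ⟨h1.lt_top, h2.lt_top⟩))
    rw [Real.enorm_eq_ofReal_abs]
    rcases abs_cases (f z).toReal with h | h
    · rw [h.1]
      exact le_self_add
    · rw [h.1]
      exact le_add_self
  refine ⟨hfin, hint, ?_⟩
  rw [lowExp, lintegral_congr_ae e1, lintegral_congr_ae e2,
    integral_eq_lintegral_pos_part_sub_lintegral_neg_part hint, EReal.coe_sub,
    EReal.coe_ennreal_toReal h1, EReal.coe_ennreal_toReal h2]

lemma lintegral_sum_dirac {ι : Type*} [Fintype ι] (lam : ι → ℝ) (z : ι → Fin n → ℝ)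
    (u : (Fin n → ℝ) → ℝ≥0∞) :
    ∫⁻ x, u x ∂(∑ i, ENNReal.ofReal (lam i) • Measure.dirac (z i)) =
      ∑ i, ENNReal.ofReal (lam i) * u (z i) := by
  rw [lintegral_finsetSum_measure]
  refine Finset.sum_congr rfl fun i _ => ?_
  rw [lintegral_smul_measure, lintegral_dirac, smul_eq_mul]

lemma lowExp_sum_dirac {ι : Type*} [Fintype ι] {lam : ι → ℝ} (h0 : ∀ i, 0 ≤ lam i)
    (z : ι → Fin n → ℝ) {f : (Fin n → ℝ) → EReal} {F : ι → ℝ} (hF : ∀ i, f (z i) = F i) :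
    lowExp (∑ i, ENNReal.ofReal (lam i) • Measure.dirac (z i)) f =
      ((∑ i, lam i * F i : ℝ) : EReal) := by
  have key : ∀ G : ι → ℝ, ((∑ i, ENNReal.ofReal (lam i) * ENNReal.ofReal (G i) : ℝ≥0∞) : EReal) =
      ((∑ i, lam i * max (G i) 0 : ℝ) : EReal) := fun G => by
    have : ∑ i, ENNReal.ofReal (lam i) * ENNReal.ofReal (G i) =
        ENNReal.ofReal (∑ i, lam i * max (G i) 0) := by
      rw [ENNReal.ofReal_sum_of_nonneg fun i _ => mul_nonneg (h0 i) (le_max_right _ _)]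
      refine Finset.sum_congr rfl fun i _ => ?_
      rw [ENNReal.ofReal_mul (h0 i), ENNReal.ofReal_max, ENNReal.ofReal_zero, max_eq_left zero_le]
    rw [this, EReal.coe_ennreal_ofReal, max_eq_left]
    exact Finset.sum_nonneg fun i _ => mul_nonneg (h0 i) (le_max_right _ _)
  rw [lowExp, lintegral_sum_dirac, lintegral_sum_dirac]
  simp only [hF, epos_coe, epos_neg_coe]
  rw [key, key, ← EReal.coe_sub, ← Finset.sum_sub_distrib]
  congr 1
  refine Finset.sum_congr rfl fun i _ => ?_
  rw [← mul_sub]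
  congr 1
  rcases le_total (F i) 0 with h | h
  · rw [max_eq_right h, max_eq_left (neg_nonneg.2 h)]
    ring
  · rw [max_eq_left h, max_eq_right (neg_nonpos.2 h)]
    ring

lemma sum_dirac_apply {ι : Type*} [Fintype ι] {lam : ι → ℝ} (h0 : ∀ i, 0 ≤ lam i)
    (h1 : ∑ i, lam i = 1) {z : ι → Fin n → ℝ} {S : Set (Fin n → ℝ)} (hz : ∀ i, z i ∈ S) :
    (∑ i, ENNReal.ofReal (lam i) • Measure.dirac (z i) : Measure (Fin n → ℝ)) S = 1 := by
  rw [Measure.finsetSum_apply, ← ENNReal.ofReal_one, ← h1,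
    ENNReal.ofReal_sum_of_nonneg fun i _ => h0 i]
  refine Finset.sum_congr rfl fun i _ => ?_
  rw [Measure.smul_apply, Measure.dirac_apply_of_mem (hz i), smul_eq_mul, mul_one]

end

section

variable {gi : Fin I → (Fin dz → ℝ) → EReal} {c : Fin L → (Fin dz → ℝ) → EReal}
  {h : Fin J → (Fin dz → ℝ) → EReal} {μ : Fin J → ℝ}

lemma mem_Sbar_iff {z : Fin dz → ℝ} :
    z ∈ Sbar gi c h ↔ z ∈ Sset c ∧ (∀ j, h j z < ⊤) ∧ ⊥ < gFun gi z := by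
  simp only [Sbar, SbarI, gFun, Set.mem_iUnion, lt_iSup_iff, Set.mem_ofPred_eq, exists_and_left]

lemma isClosed_Sset (hC : AssumptionC c) : IsClosed (Sset c) := by
  have : Sset c = ⋂ l, (fun z => (z, (0 : ℝ))) ⁻¹' epi (c l) := by
    ext z
    simp [Sset, epi]
  rw [this]
  exact isClosed_iInter fun l => (isClosed_epi (hC l).2.1).preimage (by fun_prop)

lemma exists_gFun_le (hG : AssumptionG gi) (hbd : Bornology.IsBounded (Sset c)) :
    ∃ M : ℝ, ∀ z ∈ Sset c, gFun gi z ≤ M := by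
  choose M hM0 hM using fun i => exists_lower_bound_of_isBounded (hG i).1 (hG i).2.1 hbd
  refine ⟨∑ i, M i, fun z hz => iSup_le fun i => ?_⟩
  have h1 := hM i z hz
  rw [EReal.coe_neg, EReal.neg_le_neg_iff] at h1
  exact h1.trans (EReal.coe_le_coe_iff.2
    (Finset.single_le_sum (fun k _ => hM0 k) (Finset.mem_univ i)))

lemma coe_toReal_gFun (hG : AssumptionG gi) (hbd : Bornology.IsBounded (Sset c)) {z : Fin dz → ℝ}
    (hz : z ∈ Sbar gi c h) : gFun gi z = ((gFun gi z).toReal : EReal) := by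
  obtain ⟨M, hM⟩ := exists_gFun_le hG hbd
  obtain ⟨h1, -, h2⟩ := mem_Sbar_iff.1 hz
  exact (EReal.coe_toReal ((hM z h1).trans_lt (EReal.coe_lt_top M)).ne h2.ne').symm

lemma coe_toReal_of_mem_Sbar (hH : AssumptionH h) {z : Fin dz → ℝ}
    (hz : z ∈ Sbar gi c h) (j : Fin J) : h j z = ((h j z).toReal : EReal) :=
  (EReal.coe_toReal ((mem_Sbar_iff.1 hz).2.1 j).ne ((hH j).1.1 z)).symm

lemma sum_coe_mul_eq_coe {ι : Type*} [Fintype ι] (a : ι → ℝ) {x : ι → EReal} {y : ι → ℝ}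
    (hx : ∀ i, x i = y i) : ∑ i, (a i : EReal) * x i = ((∑ i, a i * y i : ℝ) : EReal) := by
  rw [ereal_coe_sum]
  simp only [hx, EReal.coe_mul]

lemma duqVal_le_apwVal (hG : AssumptionG gi) (hH : AssumptionH h) :
    duqVal gi c h μ ≤ apwVal gi c h μ := by
  refine le_iInf₂ fun p hp => iInf₂_le (f := fun (p : ℝ × (Fin J → ℝ)) (_ : p ∈ duqFeas gi c h) =>
    ((p.1 + dotp μ p.2 : ℝ) : EReal)) p ⟨hp.1, fun z hz => iSup_le fun i => ?_⟩
  rw [sum_coe_mul_eq_coe p.2 fun j => coe_toReal_of_mem_Sbar hH hz j, ← EReal.coe_add]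
  rcases eq_or_ne (gi i z) ⊥ with hbot | hbot
  · rw [hbot]
    exact bot_le
  have hz' := mem_Sbar_iff.1 hz
  have hU := mem_Uset_of_mem_SbarI hG hH ⟨hz'.1, hz'.2.1, bot_lt_iff_ne_bot.2 hbot⟩
  have h1 := hp.2 i _ hU
  rw [dotp_comm] at h1
  simp only [dotp] at h1
  rw [← EReal.coe_toReal (fun ht => (hG i).1.1 z (by simp [ht])) hbot, EReal.coe_le_coe_iff]
  linarith

/-- Feasible solutions of (AD-B) yield at least as good solutions of (FR). -/
lemma adbFeas_to_frFeas (hG : AssumptionG gi) (hH : AssumptionH h)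
    (hbd : Bornology.IsBounded (Sset c))
    {p : (Fin I → (Fin dz → ℝ) × (Fin J → ℝ) × ℝ) × (Fin I → ℝ)} (hp : p ∈ adbFeas gi c h μ) :
    (fun i => (p.1 i).1, p.2) ∈ frFeas gi c h μ ∧
      ((∑ i, p.2 i * (p.1 i).2.2 : ℝ) : EReal) ≤ frObj gi (fun i => (p.1 i).1, p.2) := by
  obtain ⟨h1, h2, h3, h4⟩ := hp
  have hz : ∀ i, (p.1 i).1 ∈ Sbar gi c h := fun i =>
    Set.mem_iUnion.2 ⟨i, mem_SbarI_of_mem_Uset (h1 i)⟩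
  have hobj : frObj gi (fun i => (p.1 i).1, p.2) =
      ((∑ i, p.2 i * (gFun gi (p.1 i).1).toReal : ℝ) : EReal) :=
    sum_coe_mul_eq_coe _ fun i => coe_toReal_gFun hG hbd (hz i)
  refine ⟨⟨hz, h2, h3, fun j => ?_, ?_⟩, ?_⟩
  · rw [sum_coe_mul_eq_coe _ fun i => coe_toReal_of_mem_Sbar hH (hz i) j, EReal.coe_le_coe_iff]
    refine (Finset.sum_le_sum fun i _ => mul_le_mul_of_nonneg_left ?_ (h2 i)).trans (h4 j)
    rw [← EReal.coe_le_coe_iff, ← coe_toReal_of_mem_Sbar hH (hz i) j]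
    exact (h1 i).2.1 j
  · rw [hobj]
    exact EReal.coe_ne_bot _
  · rw [hobj]
    refine EReal.coe_le_coe_iff.2 (Finset.sum_le_sum fun i _ =>
      mul_le_mul_of_nonneg_left ?_ (h2 i))
    rw [← EReal.coe_le_coe_iff, ← coe_toReal_gFun hG hbd (hz i)]
    exact (h1 i).2.2.trans (le_iSup (fun i => gi i _) i)

lemma adbVal_le_frVal (hG : AssumptionG gi) (hH : AssumptionH h)
    (hbd : Bornology.IsBounded (Sset c)) : adbVal gi c h μ ≤ frVal gi c h μ := by
  refine iSup₂_le fun p hp => ?_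
  obtain ⟨h1, h2⟩ := adbFeas_to_frFeas hG hH hbd hp
  exact h2.trans (le_iSup₂ (f := fun q (_ : q ∈ frFeas gi c h μ) => frObj gi q) _ h1)

/-- Feasible solutions of (FR) are discrete distributions feasible in (P-UQ). -/
lemma sum_dirac_mem_ambSet (hG : AssumptionG gi) (hH : AssumptionH h)
    (hbd : Bornology.IsBounded (Sset c)) {z : Fin I → Fin dz → ℝ} {lam : Fin I → ℝ}
    (hp : (z, lam) ∈ frFeas gi c h μ) :
    (∑ i, ENNReal.ofReal (lam i) • Measure.dirac (z i)) ∈ ambSet c h μ ∧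
      lowExp (∑ i, ENNReal.ofReal (lam i) • Measure.dirac (z i)) (gFun gi) =
        frObj gi (z, lam) := by
  obtain ⟨h1, h2, h3, h4, -⟩ := hp
  refine ⟨⟨⟨sum_dirac_apply h2 h3 fun i => Set.mem_univ _⟩,
    sum_dirac_apply h2 h3 fun i => (mem_Sbar_iff.1 (h1 i)).1, fun j => ?_⟩, ?_⟩
  · have h5 := h4 j
    rw [sum_coe_mul_eq_coe _ fun i => coe_toReal_of_mem_Sbar hH (h1 i) j] at h5
    rw [highExp, lowExp_sum_dirac h2 z (F := fun i => -(h j (z i)).toReal) fun i => by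
      rw [EReal.coe_neg, ← coe_toReal_of_mem_Sbar hH (h1 i) j], ← EReal.coe_neg]
    simpa using h5
  · rw [lowExp_sum_dirac h2 z fun i => coe_toReal_gFun hG hbd (h1 i)]
    exact (sum_coe_mul_eq_coe _ fun i => coe_toReal_gFun hG hbd (h1 i)).symm

lemma frVal_le_puqVal (hG : AssumptionG gi) (hH : AssumptionH h)
    (hbd : Bornology.IsBounded (Sset c)) : frVal gi c h μ ≤ puqVal gi c h μ := by
  refine iSup₂_le fun p hp => ?_
  obtain ⟨h1, h2⟩ := sum_dirac_mem_ambSet hG hH hbd hp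
  rw [← Prod.mk.eta (p := p), ← h2]
  refine le_iSup₂ (f := fun P (_ : P ∈ {P | P ∈ ambSet c h μ ∧ lowExp P (gFun gi) ≠ ⊥}) =>
    lowExp P (gFun gi)) _ ⟨h1, ?_⟩
  rw [h2]
  exact hp.2.2.2.2

lemma puqVal_le_duqVal (hG : AssumptionG gi) (hC : AssumptionC c) (hH : AssumptionH h)
    (hmg : ∀ i, Measurable (gi i)) (hmh : ∀ j, Measurable (h j))
    (hbd : Bornology.IsBounded (Sset c)) : puqVal gi c h μ ≤ duqVal gi c h μ := by
  refine iSup₂_le fun P hP => le_iInf₂ fun p hp => ?_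
  obtain ⟨⟨hprob, hPS, hPh⟩, hPg⟩ := hP
  have hS : ∀ᵐ z ∂P, z ∈ Sset c :=
    (mem_ae_iff_prob_eq_one (isClosed_Sset hC).measurableSet).2 hPS
  have hfin : ∀ (f : (Fin dz → ℝ) → EReal) (a : ℝ), (∀ z ∈ Sset c, f z ≤ a) →
      ∫⁻ z, epos (f z) ∂P ≠ ⊤ := fun f a hf => by
    refine ((lintegral_mono_ae (hS.mono fun z hz => epos_le_of_le (hf z hz))).trans_lt ?_).ne
    simp
  have hneg : ∀ f : (Fin dz → ℝ) → EReal, lowExp P f ≠ ⊥ → ∫⁻ z, epos (-f z) ∂P ≠ ⊤ :=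
    fun f hf htop => hf (by rw [lowExp, htop, EReal.coe_ennreal_top, EReal.sub_top])
  obtain ⟨M, hM⟩ := exists_gFun_le hG hbd
  obtain ⟨hg1, hg2, hg3⟩ := lowExp_eq_integral (f := gFun gi) (Measurable.iSup hmg)
    (hfin _ M hM) (hneg _ hPg)
  have hh : ∀ j, (∀ᵐ z ∂P, h j z ≠ ⊤ ∧ h j z ≠ ⊥) ∧ Integrable (fun z => (h j z).toReal) P ∧
      ∫ z, (h j z).toReal ∂P ≤ μ j := by
    intro j
    obtain ⟨m, -, hm⟩ := exists_lower_bound_of_isBounded (hH j).1 (hH j).2.1 hbd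
    have hj := hPh j
    obtain ⟨h1, h2, h3⟩ := lowExp_eq_integral (f := fun z => -h j z) (hmh j).neg
      (hfin _ m fun z hz => by simpa using EReal.neg_le_neg_iff.2 (hm z hz))
      (hneg _ fun hbot => by
        rw [highExp, hbot, EReal.neg_bot] at hj
        exact EReal.coe_ne_top _ (top_le_iff.1 hj))
    rw [highExp, h3, ← EReal.coe_neg, EReal.coe_le_coe_iff] at hj
    simp only [EReal.toReal_neg_eq, integral_neg, neg_neg] at hj
    simp only [EReal.toReal_neg_eq] at h2
    refine ⟨h1.mono fun z hz => ?_, by simpa using h2.neg, hj⟩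
    simpa [and_comm] using hz
  rw [hg3, EReal.coe_le_coe_iff]
  have hle : (fun z => (gFun gi z).toReal) ≤ᵐ[P]
      fun z => p.1 + ∑ j, p.2 j * (h j z).toReal := by
    filter_upwards [hS, hg1, ae_all_iff.2 fun j => (hh j).1] with z hz1 hz2 hz3
    have hz : z ∈ Sbar gi c h :=
      mem_Sbar_iff.2 ⟨hz1, fun j => (hz3 j).1.lt_top, bot_lt_iff_ne_bot.2 hz2.2⟩
    have h1 := hp.2 z hz
    rwa [sum_coe_mul_eq_coe p.2 fun j => coe_toReal_of_mem_Sbar hH hz j,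
      coe_toReal_gFun hG hbd hz, ← EReal.coe_add, EReal.coe_le_coe_iff] at h1
  have hi : Integrable (fun z => ∑ j, p.2 j * (h j z).toReal) P :=
    integrable_finsetSum _ fun j _ => (hh j).2.1.const_mul _
  refine (integral_mono_ae hg2 ((integrable_const _).add hi) hle).trans ?_
  rw [integral_add' (integrable_const _) hi,
    integral_finsetSum _ fun j _ => (hh j).2.1.const_mul _]
  simp only [integral_const, probReal_univ, one_smul, integral_const_mul]
  rw [dotp_comm]
  exact add_le_add le_rfl (Finset.sum_le_sum fun j _ =>
    mul_le_mul_of_nonneg_left (hh j).2.2 (hp.1 j))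

end

variable {gi : Fin I → (Fin dz → ℝ) → EReal} {c : Fin L → (Fin dz → ℝ) → EReal}
  {h : Fin J → (Fin dz → ℝ) → EReal} {μ : Fin J → ℝ}

/-- Feasible solutions of (AD-B') are discrete distributions that are feasible in (P-UQ) and at
least as good. -/
lemma adbp_distribution_mem_ambSet (hG : AssumptionG gi) (hC : AssumptionC c)
    (hH : AssumptionH h) (hS : AssumptionS gi c h) (hSne : (Sset c).Nonempty)
    (hbd : Bornology.IsBounded (Sset c))
    {r : (Fin I → ℝ) × (Fin I → ℝ) × (Fin I → Fin J → ℝ) × (Fin I → Fin dz → ℝ)}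
    (hr : r ∈ adbpFeas gi c h μ) {P : Measure (Fin dz → ℝ)}
    (hP : P = ∑ i ∈ Finset.univ.filter (fun i => 0 < r.2.1 i),
      ENNReal.ofReal (r.2.1 i) • Measure.dirac ((r.2.1 i)⁻¹ • r.2.2.2 i)) :
    P ∈ ambSet c h μ ∧ ((∑ i, r.1 i : ℝ) : EReal) ≤ lowExp P (gFun gi) := by
  obtain ⟨q, hq, hqr, hle⟩ := exists_mem_adbFeas hG hC hH hS hSne hbd hr
  obtain ⟨hfr, hobj⟩ := adbFeas_to_frFeas hG hH hbd hq
  have hPq : P = ∑ i, ENNReal.ofReal (r.2.1 i) • Measure.dirac (q i).1 := by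
    rw [hP, Finset.sum_filter]
    refine Finset.sum_congr rfl fun i _ => ?_
    split_ifs with hi
    · rw [hqr i hi]
    · rw [ENNReal.ofReal_of_nonpos (not_lt.1 hi), zero_smul]
  obtain ⟨h1, h2⟩ := sum_dirac_mem_ambSet hG hH hbd hfr
  rw [hPq, h2]
  exact ⟨h1, (EReal.coe_le_coe_iff.2 hle).trans hobj⟩

end UQ

/-- **Strong duality for uncertainty quantification under a primal-side Slater
condition** (Theorem 4.2 (ii)): under assumptions (G), (C), (H) and (S), if (AP-W')
admits a Slater point and `S` is bounded, then (AP-W'), (AP-W), (D-UQ), (P-UQ), (FR),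
(AD-B) and (AD-B') all have the same optimal value and (AD-B') is solvable; moreover,
if `(τ*, λ*, ω*, υ*)` solves (AD-B'), then the discrete distribution assigning
probability `λ_i*` to `υ_i*/λ_i*` for every `i` with `λ_i* > 0` solves (P-UQ). -/
theorem uq_strong_duality_primal_side (dz I J L : ℕ)
    (gi : Fin I → (Fin dz → ℝ) → EReal) (c : Fin L → (Fin dz → ℝ) → EReal)
    (h : Fin J → (Fin dz → ℝ) → EReal) (μ : Fin J → ℝ)
    (hG : AssumptionG gi) (hC : AssumptionC c) (hH : AssumptionH h)
    (hS : AssumptionS gi c h) (hSne : (Sset c).Nonempty)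
    (hmg : ∀ i, Measurable (gi i)) (hmh : ∀ j, Measurable (h j))
    (hSlater : ∃ q, SlaterAPWP gi c h q)
    (hbd : Bornology.IsBounded (Sset c)) :
    apwpVal gi c h μ = apwVal gi c h μ ∧
    apwVal gi c h μ = duqVal gi c h μ ∧
    duqVal gi c h μ = puqVal gi c h μ ∧
    puqVal gi c h μ = frVal gi c h μ ∧
    frVal gi c h μ = adbVal gi c h μ ∧
    adbVal gi c h μ = adbpVal gi c h μ ∧
    adbpSolvable gi c h μ ∧
    (∀ r ∈ adbpFeas gi c h μ, (((∑ i, r.1 i : ℝ)) : EReal) = adbpVal gi c h μ →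
      let P : Measure (Fin dz → ℝ) :=
        ∑ i ∈ Finset.univ.filter (fun i => 0 < r.2.1 i),
          ENNReal.ofReal (r.2.1 i) • Measure.dirac ((r.2.1 i)⁻¹ • r.2.2.2 i)
      P ∈ ambSet c h μ ∧ lowExp P (gFun gi) ≠ ⊥ ∧
      lowExp P (gFun gi) = puqVal gi c h μ) := by
  have e1 := UQ.adbpVal_le_adbVal (μ := μ) hG hC hH hS hSne hbd
  have e2 := UQ.adbVal_le_frVal (μ := μ) hG hH hbd
  have e3 := UQ.frVal_le_puqVal (μ := μ) hG hH hbd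
  have e4 := UQ.puqVal_le_duqVal (μ := μ) hG hC hH hmg hmh hbd
  have e5 := UQ.duqVal_le_apwVal (c := c) (μ := μ) hG hH
  have e6 := UQ.apwVal_le_apwpVal (gi := gi) (c := c) (h := h) (μ := μ)
  have e7 := UQ.apwpVal_le_adbpVal (μ := μ) hG hC hH hS hSne hbd
  have hpa : puqVal gi c h μ = adbpVal gi c h μ :=
    (((e4.trans e5).trans e6).trans e7).antisymm ((e1.trans e2).trans e3)
  have hfa : frVal gi c h μ = adbpVal gi c h μ := (e3.trans hpa.le).antisymm (e1.trans e2)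
  have hba : adbVal gi c h μ = adbpVal gi c h μ := (e2.trans hfa.le).antisymm e1
  have hqa : apwpVal gi c h μ = adbpVal gi c h μ :=
    e7.antisymm (hpa.ge.trans ((e4.trans e5).trans e6))
  have hwa : apwVal gi c h μ = adbpVal gi c h μ :=
    (e6.trans e7).antisymm (hpa.ge.trans (e4.trans e5))
  have hda : duqVal gi c h μ = adbpVal gi c h μ :=
    ((e5.trans e6).trans e7).antisymm (hpa.ge.trans e4)
  refine ⟨hqa.trans hwa.symm, hwa.trans hda.symm, hda.trans hpa.symm, hpa.trans hfa.symm,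
    hfa.trans hba.symm, hba, UQ.adbpSolvable_of_isBounded hG hC hH hS hSne hbd,
    fun r hr hopt => ?_⟩
  intro P
  obtain ⟨h1, h2⟩ := UQ.adbp_distribution_mem_ambSet hG hC hH hS hSne hbd hr (P := P) rfl
  have hbot : lowExp P (gFun gi) ≠ ⊥ := ((EReal.bot_lt_coe _).trans_le h2).ne'
  refine ⟨h1, hbot, le_antisymm ?_ ?_⟩
  · exact le_iSup₂ (f := fun P (_ : P ∈ {P | P ∈ ambSet c h μ ∧ lowExp P (gFun gi) ≠ ⊥}) =>
      lowExp P (gFun gi)) P ⟨h1, hbot⟩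
  · rw [hpa, ← hopt]
    exact h2
end
end

section
/- Approximate numerical solution of (P-UQ): under assumptions (G), (C), (H) and (S), if (AD-B') admits a Slater point with λ > 0 (all components strictly positive), then the suprema of (P-UQ) and (AD-B') coincide, and for every ε > 0 there exists a discrete distribution P ∈ 𝒫 supported on at most I points such that E_P[g(z̃)] ≥ sup(P-UQ) − 2ε if sup(P-UQ) is finite, and E_P[g(z̃)] ≥ 1/(2ε) if sup(P-UQ) = +∞. -/
noncomputable section
open scoped BigOperators Classical ENNReal
open MeasureTheory

variable {dz I J L : ℕ}

theorem EReal.coe_mul_le_coe_iff {t : ℝ} (ht : 0 < t) (e : EReal) (a : ℝ) :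
    (t : EReal) * e ≤ a ↔ e ≤ ((t⁻¹ * a : ℝ) : EReal) := by
  induction e with
  | bot => simp [EReal.coe_mul_bot_of_pos ht]
  | top =>
    rw [EReal.coe_mul_top_of_pos ht, top_le_iff, top_le_iff]
    exact iff_of_false (EReal.coe_ne_top _) (EReal.coe_ne_top _)
  | coe x =>
    rw [← EReal.coe_mul, EReal.coe_le_coe_iff, EReal.coe_le_coe_iff, le_inv_mul_iff₀ ht]

theorem persp_le_iff_of_pos {n : ℕ} (f : (Fin n → ℝ) → EReal) (x : Fin n → ℝ) {t : ℝ}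
    (ht : 0 < t) (a : ℝ) :
    persp f x t ≤ a ↔ f (t⁻¹ • x) ≤ ((t⁻¹ * a : ℝ) : EReal) := by
  rw [persp, if_pos ht, EReal.coe_mul_le_coe_iff ht]

theorem persp_one {n : ℕ} (f : (Fin n → ℝ) → EReal) (x : Fin n → ℝ) : persp f x 1 = f x := by
  simp [persp]

theorem persp_zero_le_iff {n : ℕ} (f : (Fin n → ℝ) → EReal) (x : Fin n → ℝ) (a : ℝ) :
    persp f x 0 ≤ a ↔ ∀ w ∈ edom (conjFn f), dotp w x ≤ a := by
  simp only [persp, lt_irrefl, if_false, suppFn, iSup_le_iff, EReal.coe_le_coe_iff]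

theorem cpersp_eq_neg_persp {n : ℕ} (g : (Fin n → ℝ) → EReal) (x : Fin n → ℝ) (t : ℝ) :
    cpersp g x t = -persp (fun z => -g z) x t := by
  unfold cpersp persp
  split_ifs <;> simp [mul_neg]

theorem dotp_add_right {n : ℕ} (w x y : Fin n → ℝ) : dotp w (x + y) = dotp w x + dotp w y :=
  dotProduct_add w x y

theorem dotp_add_left {n : ℕ} (w x y : Fin n → ℝ) : dotp (w + x) y = dotp w y + dotp x y :=
  add_dotProduct w x y

theorem dotp_smul_right {n : ℕ} (k : ℝ) (w x : Fin n → ℝ) : dotp w (k • x) = k * dotp w x :=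
  dotProduct_smul k w x

theorem dotp_smul_left {n : ℕ} (k : ℝ) (w x : Fin n → ℝ) : dotp (k • w) x = k * dotp w x :=
  smul_dotProduct k w x

theorem conjFn_le_iff {n : ℕ} (f : (Fin n → ℝ) → EReal) (hf : ∀ x, f x ≠ ⊥) (w : Fin n → ℝ)
    (γ : ℝ) :
    conjFn f w ≤ γ ↔ ∀ (x : Fin n → ℝ) (r : ℝ), f x ≤ r → dotp w x - r ≤ γ := by
  simp only [conjFn, iSup_le_iff]
  refine forall_congr' fun x => ?_
  have hx := hf x
  generalize f x = e at hx
  induction e with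
  | bot => exact absurd rfl hx
  | top => simp
  | coe y =>
    rw [← EReal.coe_sub, EReal.coe_le_coe_iff]
    simp only [EReal.coe_le_coe_iff]
    exact ⟨fun h r hr => by linarith, fun h => h y le_rfl⟩

theorem mem_edom_conjFn_iff {n : ℕ} (f : (Fin n → ℝ) → EReal) (hf : ∀ x, f x ≠ ⊥)
    (w : Fin n → ℝ) :
    w ∈ edom (conjFn f) ↔
      ∃ γ : ℝ, ∀ (x : Fin n → ℝ) (r : ℝ), f x ≤ r → dotp w x - r ≤ γ := by
  simp only [← conjFn_le_iff f hf]
  change conjFn f w < ⊤ ↔ _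
  generalize conjFn f w = e
  induction e with
  | bot => simp
  | top => simp
  | coe y => simpa using ⟨y, le_rfl⟩

/-- A point strictly below the graph of a closed convex function is strictly separated from the
epigraph. -/
theorem exists_separation_of_lt {n : ℕ} {f : (Fin n → ℝ) → EReal} (hfp : ProperFn f)
    (hfl : LowerSemicontinuous f) (hfc : ConvexFn f) {x₀ : Fin n → ℝ} {r₀ : ℝ}
    (hlt : (r₀ : EReal) < f x₀) :
    ∃ (w : Fin n → ℝ) (s γ : ℝ), 0 ≤ s ∧
      (∀ (x : Fin n → ℝ) (r : ℝ), f x ≤ r → dotp w x - s * r < γ) ∧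
      γ < dotp w x₀ - s * r₀ := by
  have hclosed : IsClosed {p : (Fin n → ℝ) × ℝ | f p.1 ≤ (p.2 : EReal)} :=
    hfl.isClosed_epigraph.preimage
      (continuous_fst.prodMk (continuous_coe_real_ereal.comp continuous_snd))
  obtain ⟨φ, γ, hφ, hγ⟩ := geometric_hahn_banach_closed_point
    (x := (x₀, r₀)) hfc hclosed (not_le.2 hlt)
  have hrep : ∀ (x : Fin n → ℝ) (r : ℝ),
      φ (x, r) = dotp (fun i => φ (Pi.single i 1, 0)) x + φ (0, 1) * r := by
    intro x r
    have hxr : ((x, r) : (Fin n → ℝ) × ℝ) =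
        ∑ i, x i • ((Pi.single i 1, 0) : (Fin n → ℝ) × ℝ) + r • ((0, 1) : (Fin n → ℝ) × ℝ) := by
      ext i
      · simp [Prod.fst_sum, Finset.sum_apply, Pi.single_apply]
      · simp [Prod.snd_sum]
    conv_lhs => rw [hxr]
    simp only [map_add, map_sum, map_smul, smul_eq_mul, dotp, mul_comm]
  refine ⟨fun i => φ (Pi.single i 1, 0), -φ (0, 1), γ, ?_, ?_, ?_⟩
  · by_contra! hs
    obtain ⟨x, hx⟩ := hfp.2
    have hm : f x ≤ ((f x).toReal : EReal) := EReal.le_coe_toReal hx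
    set d := dotp (fun i => φ (Pi.single i 1, 0)) x
    set s := φ (0, 1)
    have hs' : 0 < s := by linarith
    let r := max (f x).toReal ((γ - d) / s)
    have hr : f x ≤ (r : EReal) := hm.trans (EReal.coe_le_coe_iff.2 (le_max_left _ _))
    have h1 := hφ (x, r) hr
    rw [hrep] at h1
    have h2 : (γ - d) / s ≤ r := le_max_right _ _
    rw [div_le_iff₀ hs'] at h2
    linarith
  · intro x r hr
    have := hφ (x, r) hr
    rw [hrep] at this
    linarith
  · rw [hrep] at hγ
    linarith

theorem edom_conjFn_nonempty {n : ℕ} {f : (Fin n → ℝ) → EReal} (hfp : ProperFn f)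
    (hfl : LowerSemicontinuous f) (hfc : ConvexFn f) : (edom (conjFn f)).Nonempty := by
  obtain ⟨x₀, hx₀⟩ := hfp.2
  have hx : f x₀ = ((f x₀).toReal : EReal) := (EReal.coe_toReal hx₀ (hfp.1 _)).symm
  have hlt : (((f x₀).toReal - 1 : ℝ) : EReal) < f x₀ := by
    rw [hx, EReal.coe_lt_coe_iff, EReal.toReal_coe]
    linarith
  obtain ⟨w, s, γ, hs, hγ, hw⟩ := exists_separation_of_lt hfp hfl hfc hlt
  have h0 := hγ x₀ _ hx.le
  have hspos : 0 < s := by nlinarith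
  refine ⟨s⁻¹ • w, (mem_edom_conjFn_iff f hfp.1 _).2 ⟨s⁻¹ * γ, fun x r hr => ?_⟩⟩
  have := mul_le_mul_of_nonneg_left (hγ x r hr).le (inv_nonneg.2 hs)
  rw [mul_sub, inv_mul_cancel_left₀ hspos.ne'] at this
  rwa [dotp_smul_left]

/-- The support function of `dom f*` bounds the growth of `f` along any direction. -/
theorem apply_add_le_of_recession {n : ℕ} {f : (Fin n → ℝ) → EReal} (hfp : ProperFn f)
    (hfl : LowerSemicontinuous f) (hfc : ConvexFn f) {z y : Fin n → ℝ} {a b : ℝ}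
    (hz : f z ≤ a) (hy : ∀ w ∈ edom (conjFn f), dotp w y ≤ b) :
    f (z + y) ≤ ((a + b : ℝ) : EReal) := by
  by_contra! hlt
  obtain ⟨w, s, γ, hs, hγ, hw⟩ := exists_separation_of_lt hfp hfl hfc hlt
  have hza := hγ z a hz
  rw [dotp_add_right] at hw
  rcases hs.eq_or_lt with rfl | hs
  · obtain ⟨w₀, hw₀⟩ := edom_conjFn_nonempty hfp hfl hfc
    obtain ⟨γ₀, hγ₀⟩ := (mem_edom_conjFn_iff f hfp.1 _).1 hw₀
    have hpos : 0 < dotp w y := by linarith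
    obtain ⟨k, hk⟩ := exists_nat_gt ((b - dotp w₀ y) / dotp w y)
    rw [div_lt_iff₀ hpos] at hk
    have := hy (w₀ + (k : ℝ) • w) ((mem_edom_conjFn_iff f hfp.1 _).2
      ⟨γ₀ + k * γ, fun x r hr => by
        have h1 := hγ₀ x r hr
        have h2 := mul_le_mul_of_nonneg_left (hγ x r hr).le (Nat.cast_nonneg (α := ℝ) k)
        rw [dotp_add_left, dotp_smul_left]
        linarith⟩)
    rw [dotp_add_left, dotp_smul_left] at this
    linarith
  · have := hy (s⁻¹ • w) ((mem_edom_conjFn_iff f hfp.1 _).2 ⟨s⁻¹ * γ, fun x r hr => by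
      have := mul_le_mul_of_nonneg_left (hγ x r hr).le (inv_nonneg.2 hs.le)
      rw [mul_sub, inv_mul_cancel_left₀ hs.ne'] at this
      rwa [dotp_smul_left]⟩)
    rw [dotp_smul_left, inv_mul_le_iff₀ hs] at this
    linarith

theorem persp_add_le_of_eq_zero {n : ℕ} {f : (Fin n → ℝ) → EReal} (hfp : ProperFn f)
    (hfl : LowerSemicontinuous f) (hfc : ConvexFn f) {x y : Fin n → ℝ} {s a b : ℝ}
    (hs : 0 ≤ s) (hx : persp f x s ≤ a) (hy : persp f y 0 ≤ b) :
    persp f (x + y) s ≤ ((a + b : ℝ) : EReal) := by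
  rw [persp_zero_le_iff] at hy
  rcases hs.eq_or_lt with rfl | hs
  · rw [persp_zero_le_iff] at hx ⊢
    intro w hw
    rw [dotp_add_right]
    exact add_le_add (hx w hw) (hy w hw)
  · rw [persp_le_iff_of_pos _ _ hs] at hx ⊢
    rw [smul_add, mul_add]
    refine apply_add_le_of_recession hfp hfl hfc hx fun w hw => ?_
    rw [dotp_smul_right]
    exact mul_le_mul_of_nonneg_left (hy w hw) (inv_nonneg.2 hs.le)

/-- The perspective of a closed convex function is subadditive, including at `t = 0`. -/
theorem persp_add_le {n : ℕ} {f : (Fin n → ℝ) → EReal} (hfp : ProperFn f)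
    (hfl : LowerSemicontinuous f) (hfc : ConvexFn f) {x y : Fin n → ℝ} {s t a b : ℝ}
    (hs : 0 ≤ s) (ht : 0 ≤ t) (hx : persp f x s ≤ a) (hy : persp f y t ≤ b) :
    persp f (x + y) (s + t) ≤ ((a + b : ℝ) : EReal) := by
  rcases ht.eq_or_lt with rfl | ht
  · rw [add_zero]
    exact persp_add_le_of_eq_zero hfp hfl hfc hs hx hy
  rcases hs.eq_or_lt with rfl | hs
  · rw [zero_add, add_comm x, add_comm a]
    exact persp_add_le_of_eq_zero hfp hfl hfc ht.le hy hx
  have hst : 0 < s + t := add_pos hs ht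
  rw [persp_le_iff_of_pos _ _ hs] at hx
  rw [persp_le_iff_of_pos _ _ ht] at hy
  rw [persp_le_iff_of_pos _ _ hst]
  have := hfc (x := (s⁻¹ • x, s⁻¹ * a)) hx (y := (t⁻¹ • y, t⁻¹ * b)) hy
    (div_nonneg hs.le hst.le) (div_nonneg ht.le hst.le) (by field_simp)
  have h1 : (s / (s + t)) • s⁻¹ • x + (t / (s + t)) • t⁻¹ • y = (s + t)⁻¹ • (x + y) := by
    rw [smul_smul, smul_smul, smul_add]
    congr 2 <;> field_simp
  have h2 : s / (s + t) * (s⁻¹ * a) + t / (s + t) * (t⁻¹ * b) = (s + t)⁻¹ * (a + b) := by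
    field_simp
  rw [← h1, ← h2]
  exact this

theorem persp_zero_zero_le {n : ℕ} (f : (Fin n → ℝ) → EReal) {a : ℝ} (ha : 0 ≤ a) :
    persp f 0 0 ≤ a := by
  rw [persp_zero_le_iff]
  intro w _
  simpa [dotp] using ha

theorem persp_smul_le {n : ℕ} {f : (Fin n → ℝ) → EReal} {x : Fin n → ℝ} {t a k : ℝ}
    (hk : 0 ≤ k) (ht : 0 ≤ t) (hx : persp f x t ≤ a) :
    persp f (k • x) (k * t) ≤ ((k * a : ℝ) : EReal) := by
  rcases hk.eq_or_lt with rfl | hk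
  · simpa using persp_zero_zero_le f le_rfl
  rcases ht.eq_or_lt with rfl | ht
  · rw [mul_zero]
    rw [persp_zero_le_iff] at hx ⊢
    intro w hw
    rw [dotp_smul_right]
    exact mul_le_mul_of_nonneg_left (hx w hw) hk.le
  · rw [persp_le_iff_of_pos _ _ ht] at hx
    rw [persp_le_iff_of_pos _ _ (mul_pos hk ht), smul_smul]
    have h1 : (k * t)⁻¹ * k = t⁻¹ := by field_simp
    have h2 : (k * t)⁻¹ * (k * a) = t⁻¹ * a := by field_simp
    rwa [h1, h2]

/-- In finite dimension, the mean of a random vector lies in every convex set that contains the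
vector almost surely, whether or not the set is closed. -/
theorem convex_integral_mem_of_finrank {Ω : Type*} [MeasurableSpace Ω] (P : Measure Ω)
    [IsProbabilityMeasure P] (n : ℕ) :
    ∀ (E : Type) [NormedAddCommGroup E] [NormedSpace ℝ E] [FiniteDimensional ℝ E]
      (_ : Module.finrank ℝ E = n) (C : Set E) (_ : Convex ℝ C) (f : Ω → E)
      (_ : Integrable f P) (_ : ∀ᵐ ω ∂P, f ω ∈ C), ∫ ω, f ω ∂P ∈ C := by
  induction n using Nat.strong_induction_on with
  | _ n ih =>
  intro E _ _ _ hn C hC f hf hfC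
  by_contra hx
  have hsupp : ∃ φ : E →L[ℝ] ℝ, φ ≠ 0 ∧ ∀ᵐ ω ∂P, φ (f ω) = φ (∫ ω, f ω ∂P) := by
    by_cases hint : (interior C).Nonempty
    · obtain ⟨φ, hφ0, hφ⟩ := geometric_hahn_banach_of_nonempty_interior_point hC
        (fun h => hx (interior_subset h)) hint
      refine ⟨φ, hφ0, ?_⟩
      have hnn : 0 ≤ᵐ[P] fun ω => φ (∫ ω, f ω ∂P) - φ (f ω) := by
        filter_upwards [hfC] with ω hω
        simpa using hφ _ hω
      have hφf := φ.integrable_comp hf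
      have h0 : ∫ ω, (φ (∫ ω, f ω ∂P) - φ (f ω)) ∂P = 0 := by
        rw [integral_sub (integrable_const _) hφf, φ.integral_comp_comm hf]
        simp
      rw [integral_eq_zero_iff_of_nonneg_ae hnn ((integrable_const _).sub hφf)] at h0
      filter_upwards [h0] with ω hω
      simp only [Pi.zero_apply] at hω
      linarith
    · rw [hC.interior_nonempty_iff_affineSpan_eq_top] at hint
      obtain ⟨ω₀, hω₀⟩ := hfC.exists
      have hdir : (affineSpan ℝ C).direction < ⊤ := by
        refine lt_top_iff_ne_top.2 fun h => hint ?_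
        exact (AffineSubspace.direction_eq_top_iff_of_nonempty
          ⟨_, subset_affineSpan ℝ C hω₀⟩).1 h
      obtain ⟨φ, hφ0, hφ⟩ := Submodule.exists_le_ker_of_lt_top _ hdir
      have hconst : ∀ᵐ ω ∂P, φ.toContinuousLinearMap (f ω) = φ (f ω₀) := by
        filter_upwards [hfC] with ω hω
        have : f ω -ᵥ f ω₀ ∈ (affineSpan ℝ C).direction :=
          AffineSubspace.vsub_mem_direction (subset_affineSpan ℝ C hω) (subset_affineSpan ℝ C hω₀)
        have := hφ this
        simpa [sub_eq_zero] using this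
      refine ⟨φ.toContinuousLinearMap, by simpa using hφ0, ?_⟩
      have : φ.toContinuousLinearMap (∫ ω, f ω ∂P) = φ (f ω₀) := by
        rw [← ContinuousLinearMap.integral_comp_comm _ hf, integral_congr_ae hconst]
        simp
      rw [this]
      exact hconst
  obtain ⟨φ, hφ0, hφ⟩ := hsupp
  set x := ∫ ω, f ω ∂P with hxdef
  let K := LinearMap.ker (φ : E →ₗ[ℝ] ℝ)
  have hK : Module.finrank ℝ K < n := by
    rw [← hn]
    refine Submodule.finrank_lt fun h => hφ0 ?_
    ext v
    have : v ∈ K := by rw [h]; trivial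
    simpa [K] using this
  obtain ⟨p, hp⟩ := Submodule.ClosedComplemented.of_finiteDimensional (𝕜 := ℝ) K
  have hmem := ih _ hK K rfl {k : K | x + (k : E) ∈ C}
    (by
      intro a ha b hb s t hs ht hst
      have := hC ha hb hs ht hst
      have hadd : s • (x + (a : E)) + t • (x + (b : E)) = x + ((s • a + t • b : K) : E) := by
        have : x = (s + t) • x := by rw [hst, one_smul]
        conv_rhs => rw [this]
        push_cast
        module
      change x + _ ∈ C
      rwa [← hadd])
    (fun ω => p (f ω - x)) (p.integrable_comp (hf.sub (integrable_const _)))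
    (by
      filter_upwards [hφ, hfC] with ω h1 h2
      have hk : f ω - x ∈ K := by simp [K, h1]
      have := hp ⟨_, hk⟩
      simp only at this
      simp [this, h2])
  have hzero : ∫ ω, p (f ω - x) ∂P = 0 := by
    have h0 : ∫ ω, (f ω - x) ∂P = 0 := by
      rw [integral_sub hf (integrable_const _)]
      simp [← hxdef]
    have hcomm := p.integral_comp_comm (hf.sub (integrable_const x))
    simp only [Pi.sub_apply] at hcomm
    rw [hcomm, h0, map_zero]
  rw [hzero] at hmem
  apply hx
  simpa using hmem

/-- Feasibility in (AD-B') expressed through convex perspectives only. -/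
theorem mem_adbpFeas_iff {dz I J L : ℕ}
    {gi : Fin I → (Fin dz → ℝ) → EReal}
    {c : Fin L → (Fin dz → ℝ) → EReal} {h : Fin J → (Fin dz → ℝ) → EReal} {μ : Fin J → ℝ}
    {r : (Fin I → ℝ) × (Fin I → ℝ) × (Fin I → Fin J → ℝ) × (Fin I → Fin dz → ℝ)} :
    r ∈ adbpFeas gi c h μ ↔
      (∑ i, r.2.1 i) = 1 ∧ (∀ j, (∑ i, r.2.2.1 i j) ≤ μ j) ∧ (∀ i, 0 ≤ r.2.1 i) ∧
      (∀ i ℓ, persp (c ℓ) (r.2.2.2 i) (r.2.1 i) ≤ ((0 : ℝ) : EReal)) ∧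
      (∀ i j, persp (h j) (r.2.2.2 i) (r.2.1 i) ≤ ((r.2.2.1 i j : ℝ) : EReal)) ∧
      (∀ i, persp (fun z => -gi i z) (r.2.2.2 i) (r.2.1 i) ≤ ((-r.1 i : ℝ) : EReal)) := by
  simp only [adbpFeas, adbpConC, adbpConH, adbpConG, cpersp_eq_neg_persp, EReal.sub_nonpos,
    EReal.coe_neg, EReal.coe_zero, EReal.le_neg (a := ((_ : ℝ) : EReal))]
  rfl

/-- The feasible region of (AD-B') is jointly convex in the variables and the moment bounds. -/
theorem adbpFeas_combo {dz I J L : ℕ}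
    {gi : Fin I → (Fin dz → ℝ) → EReal}
    {c : Fin L → (Fin dz → ℝ) → EReal} {h : Fin J → (Fin dz → ℝ) → EReal}
    (hG : AssumptionG gi) (hC : AssumptionC c) (hH : AssumptionH h) {μ μ' : Fin J → ℝ}
    {r r' : (Fin I → ℝ) × (Fin I → ℝ) × (Fin I → Fin J → ℝ) × (Fin I → Fin dz → ℝ)}
    (hr : r ∈ adbpFeas gi c h μ) (hr' : r' ∈ adbpFeas gi c h μ') {a b : ℝ}
    (ha : 0 ≤ a) (hb : 0 ≤ b) (hab : a + b = 1) :
    a • r + b • r' ∈ adbpFeas gi c h (a • μ + b • μ') := by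
  rw [mem_adbpFeas_iff] at hr hr' ⊢
  obtain ⟨h1, h2, h3, h4, h5, h6⟩ := hr
  obtain ⟨h1', h2', h3', h4', h5', h6'⟩ := hr'
  simp only [Prod.fst_add, Prod.snd_add, Prod.smul_fst, Prod.smul_snd, Pi.add_apply,
    Pi.smul_apply, smul_eq_mul, Finset.sum_add_distrib, ← Finset.mul_sum]
  refine ⟨by rw [h1, h1', mul_one, mul_one, hab], fun j => ?_, fun i => ?_, fun i ℓ => ?_,
    fun i j => ?_, fun i => ?_⟩
  · exact add_le_add (mul_le_mul_of_nonneg_left (h2 j) ha) (mul_le_mul_of_nonneg_left (h2' j) hb)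
  · exact add_nonneg (mul_nonneg ha (h3 i)) (mul_nonneg hb (h3' i))
  · simpa using persp_add_le (hC ℓ).1 (hC ℓ).2.1.1 (hC ℓ).2.2 (mul_nonneg ha (h3 i))
      (mul_nonneg hb (h3' i)) (persp_smul_le ha (h3 i) (h4 i ℓ))
      (persp_smul_le hb (h3' i) (h4' i ℓ))
  · exact persp_add_le (hH j).1 (hH j).2.1.1 (hH j).2.2 (mul_nonneg ha (h3 i))
      (mul_nonneg hb (h3' i)) (persp_smul_le ha (h3 i) (h5 i j))
      (persp_smul_le hb (h3' i) (h5' i j))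
  · have := persp_add_le (hG i).1 (hG i).2.1.1 (hG i).2.2 (mul_nonneg ha (h3 i))
      (mul_nonneg hb (h3' i)) (persp_smul_le ha (h3 i) (h6 i))
      (persp_smul_le hb (h3' i) (h6' i))
    rwa [mul_neg, mul_neg, ← neg_add] at this

theorem epos_coe (x : ℝ) : epos (x : EReal) = ENNReal.ofReal x := by
  simp [epos]

theorem epos_mono : Monotone epos := by
  intro x y hxy
  unfold epos
  split_ifs with h1 h2
  · exact le_rfl
  · exact absurd (top_le_iff.1 (h1 ▸ hxy)) h2
  · exact le_top
  · by_cases hx : x = ⊥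
    · simp [hx]
    · exact ENNReal.ofReal_le_ofReal (EReal.toReal_le_toReal hxy hx ‹_›)

theorem measurable_epos : Measurable epos :=
  Measurable.ite (measurableSet_singleton _) measurable_const
    measurable_ereal_toReal.ennreal_ofReal

theorem coe_sum_mul_le_lowExp_sum_dirac {n m : ℕ} {lam : Fin m → ℝ} (hlam : ∀ i, 0 ≤ lam i)
    (pts : Fin m → Fin n → ℝ) (f : (Fin n → ℝ) → EReal) (y : Fin m → ℝ)
    (hy : ∀ i, (y i : EReal) ≤ f (pts i)) :
    ((∑ i, lam i * y i : ℝ) : EReal) ≤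
      lowExp (∑ i, ENNReal.ofReal (lam i) • Measure.dirac (pts i)) f := by
  have key : ∀ x : Fin m → ℝ,
      (((∑ i, ENNReal.ofReal (lam i) * ENNReal.ofReal (x i) : ℝ≥0∞)) : EReal) = ((∑ i, lam i * max (x i) 0 : ℝ) : EReal) := by
    intro x
    have : ∑ i, ENNReal.ofReal (lam i) * ENNReal.ofReal (x i) =
        ENNReal.ofReal (∑ i, lam i * max (x i) 0) := by
      rw [ENNReal.ofReal_sum_of_nonneg fun i _ => mul_nonneg (hlam i) (le_max_right _ _)]
      refine Finset.sum_congr rfl fun i _ => ?_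
      rw [ENNReal.ofReal_mul (hlam i)]
      simp
    rw [this, EReal.coe_ennreal_ofReal, max_eq_left]
    exact Finset.sum_nonneg fun i _ => mul_nonneg (hlam i) (le_max_right _ _)
  simp only [lowExp, lintegral_finsetSum_measure, lintegral_smul_measure, lintegral_dirac,
    smul_eq_mul]
  have hsplit : ((∑ i, lam i * y i : ℝ) : EReal) =
      ((∑ i, ENNReal.ofReal (lam i) * ENNReal.ofReal (y i) : ℝ≥0∞) : EReal) -
      ((∑ i, ENNReal.ofReal (lam i) * ENNReal.ofReal (-y i) : ℝ≥0∞) : EReal) := by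
    rw [key, key, ← EReal.coe_sub, ← Finset.sum_sub_distrib]
    congr 1
    refine Finset.sum_congr rfl fun i _ => ?_
    rw [← mul_sub]
    rcases le_total 0 (y i) with h | h <;> simp [h]
  rw [hsplit]
  refine EReal.sub_le_sub (EReal.coe_ennreal_le_coe_ennreal_iff.2 ?_)
    (EReal.coe_ennreal_le_coe_ennreal_iff.2 ?_)
  · gcongr with i
    rw [← epos_coe]
    exact epos_mono (hy i)
  · gcongr with i
    rw [← epos_coe, EReal.coe_neg]
    exact epos_mono (EReal.neg_le_neg_iff.2 (hy i))

theorem sum_dirac_mem_ambSet {dz I J L : ℕ}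
    {c : Fin L → (Fin dz → ℝ) → EReal}
    {h : Fin J → (Fin dz → ℝ) → EReal} {μ : Fin J → ℝ} {lam : Fin I → ℝ}
    {pts : Fin I → Fin dz → ℝ} (hlam : ∀ i, 0 ≤ lam i) (hsum : ∑ i, lam i = 1)
    (hpts : ∀ i, pts i ∈ Sset c) {u : Fin I → Fin J → ℝ}
    (hu : ∀ i j, h j (pts i) ≤ (u i j : EReal)) (hμ : ∀ j, ∑ i, lam i * u i j ≤ μ j) :
    (∑ i, ENNReal.ofReal (lam i) • Measure.dirac (pts i)) ∈ ambSet c h μ := by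
  have hone : ∑ i, ENNReal.ofReal (lam i) = 1 := by
    rw [← ENNReal.ofReal_sum_of_nonneg fun i _ => hlam i, hsum, ENNReal.ofReal_one]
  refine ⟨⟨by simpa using hone⟩, ?_, fun j => ?_⟩
  · simpa [Measure.dirac_apply_of_mem (hpts _)] using hone
  · rw [highExp, EReal.neg_le]
    refine le_trans ?_ (coe_sum_mul_le_lowExp_sum_dirac hlam pts _ (fun i => -u i j) fun i => ?_)
    · rw [← EReal.coe_neg, EReal.coe_le_coe_iff]
      simpa using hμ j
    · rw [EReal.coe_neg]
      exact EReal.neg_le_neg_iff.2 (hu i j)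

/-- Every value strictly below the supremum of (AD-B') is attained by the expected disutility of a
discrete distribution: perturb a near-optimal solution towards a feasible one with `λ > 0`. -/
theorem exists_discrete_of_lt_adbpVal {dz I J L : ℕ}
    {gi : Fin I → (Fin dz → ℝ) → EReal}
    {c : Fin L → (Fin dz → ℝ) → EReal} {h : Fin J → (Fin dz → ℝ) → EReal} {μ : Fin J → ℝ}
    (hG : AssumptionG gi) (hC : AssumptionC c) (hH : AssumptionH h)
    {s : (Fin I → ℝ) × (Fin I → ℝ) × (Fin I → Fin J → ℝ) × (Fin I → Fin dz → ℝ)}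
    (hs : s ∈ adbpFeas gi c h μ) (hspos : ∀ i, 0 < s.2.1 i) {b : ℝ}
    (hb : (b : EReal) < adbpVal gi c h μ) :
    ∃ (lam : Fin I → ℝ) (pts : Fin I → Fin dz → ℝ),
      (∀ i, 0 ≤ lam i) ∧ (∑ i, lam i) = 1 ∧
      (∑ i, ENNReal.ofReal (lam i) • Measure.dirac (pts i)) ∈ ambSet c h μ ∧
      (b : EReal) ≤
        lowExp (∑ i, ENNReal.ofReal (lam i) • Measure.dirac (pts i)) (gFun gi) := by
  simp only [adbpVal, lt_iSup_iff, EReal.coe_lt_coe_iff] at hb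
  obtain ⟨r, hr, hbr⟩ := hb
  obtain ⟨θ, hθ0, hθ1, hθ⟩ : ∃ θ : ℝ, 0 < θ ∧ θ ≤ 1 ∧
      b ≤ (1 - θ) * ∑ i, r.1 i + θ * ∑ i, s.1 i := by
    set R := ∑ i, r.1 i
    set T := ∑ i, s.1 i
    have hden : 0 < R - b + |R - T| := by linarith [abs_nonneg (R - T)]
    refine ⟨(R - b) / (R - b + |R - T|), div_pos (by linarith) hden, ?_, ?_⟩
    · rw [div_le_one hden]
      linarith [abs_nonneg (R - T)]
    · set θ := (R - b) / (R - b + |R - T|) with hθ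
      have h1 : θ * (R - b + |R - T|) = R - b := div_mul_cancel₀ _ hden.ne'
      have h0 : 0 ≤ θ := (div_pos (by linarith) hden).le
      have h2 := mul_le_mul_of_nonneg_left (le_abs_self (R - T)) h0
      have h3 := mul_nonneg h0 (sub_nonneg.2 hbr.le)
      linarith
  have hq := adbpFeas_combo hG hC hH hr hs (sub_nonneg.2 hθ1) hθ0.le (by ring)
  have hμ : (1 - θ) • μ + θ • μ = μ := by module
  rw [hμ] at hq
  set q := (1 - θ) • r + θ • s with hqdef
  have hbq : b ≤ ∑ i, q.1 i := by
    simpa [hqdef, Finset.sum_add_distrib, ← Finset.mul_sum] using hθ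
  have hqpos : ∀ i, 0 < q.2.1 i := fun i => by
    have h1 := mul_nonneg (sub_nonneg.2 hθ1) ((mem_adbpFeas_iff.1 hr).2.2.1 i)
    have h2 := mul_pos hθ0 (hspos i)
    simpa [hqdef] using add_pos_of_nonneg_of_pos h1 h2
  obtain ⟨h1, h2, -, h4, h5, h6⟩ := mem_adbpFeas_iff.1 hq
  have hcancel : ∀ i (x : ℝ), q.2.1 i * ((q.2.1 i)⁻¹ * x) = x := fun i x =>
    mul_inv_cancel_left₀ (hqpos i).ne' x
  refine ⟨q.2.1, fun i => (q.2.1 i)⁻¹ • q.2.2.2 i, fun i => (hqpos i).le, h1, ?_, ?_⟩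
  · refine sum_dirac_mem_ambSet (u := fun i j => (q.2.1 i)⁻¹ * q.2.2.1 i j)
      (fun i => (hqpos i).le) h1 (fun i ℓ => ?_) (fun i j => ?_) (fun j => ?_)
    · simpa using (persp_le_iff_of_pos _ _ (hqpos i) _).1 (h4 i ℓ)
    · exact (persp_le_iff_of_pos _ _ (hqpos i) _).1 (h5 i j)
    · simpa only [hcancel] using h2 j
  · refine le_trans ?_ (coe_sum_mul_le_lowExp_sum_dirac (fun i => (hqpos i).le) _ _
      (fun i => (q.2.1 i)⁻¹ * q.1 i) fun i => ?_)
    · simpa only [hcancel, EReal.coe_le_coe_iff] using hbq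
    · refine le_trans ?_ (le_iSup (fun k => gi k _) i)
      have := (persp_le_iff_of_pos _ _ (hqpos i) _).1 (h6 i)
      rw [mul_neg, EReal.coe_neg] at this
      exact EReal.neg_le_neg_iff.1 this

/-- A real lower bound on the extended expectation of `f` is also a lower bound on the mean of some
integrable minorant of `f`. -/
theorem exists_integrable_le_of_le_lowExp {n : ℕ} {P : Measure (Fin n → ℝ)}
    [IsFiniteMeasure P] {f : (Fin n → ℝ) → EReal} (hf : Measurable f) {b : ℝ}
    (hb : (b : EReal) ≤ lowExp P f) :
    ∃ φ : (Fin n → ℝ) → ℝ, Integrable φ P ∧ (∀ᵐ z ∂P, (φ z : EReal) ≤ f z) ∧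
      b ≤ ∫ z, φ z ∂P := by
  have hpm : Measurable fun z => epos (f z) := measurable_epos.comp hf
  have hnm : Measurable fun z => epos (-f z) := measurable_epos.comp hf.neg
  have hneg : ∫⁻ z, epos (-f z) ∂P ≠ ⊤ := by
    intro htop
    rw [lowExp, htop, EReal.coe_ennreal_top, EReal.sub_top, le_bot_iff] at hb
    exact EReal.coe_ne_bot _ hb
  obtain ⟨ψ, hψm, hψle, hψtop, hψb⟩ : ∃ ψ : (Fin n → ℝ) → ℝ≥0∞, Measurable ψ ∧
      (∀ z, ψ z ≤ epos (f z)) ∧ ∫⁻ z, ψ z ∂P ≠ ⊤ ∧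
      b ≤ (∫⁻ z, ψ z ∂P).toReal - (∫⁻ z, epos (-f z) ∂P).toReal := by
    by_cases hpos : ∫⁻ z, epos (f z) ∂P = ⊤
    · have hsup : ⨆ k : ℕ, ∫⁻ z, min (epos (f z)) k ∂P = ⊤ := by
        rw [← lintegral_iSup (fun k => hpm.min measurable_const)
          (fun k l hkl z => min_le_min_left _ (Nat.cast_le.2 hkl)), ← hpos]
        refine lintegral_congr fun z => ?_
        rw [← inf_iSup_eq, ENNReal.iSup_natCast, inf_top_eq]
      obtain ⟨k, hk⟩ := lt_iSup_iff.1 (hsup ▸ ENNReal.ofReal_lt_top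
        (r := b + (∫⁻ z, epos (-f z) ∂P).toReal))
      have hfin : ∫⁻ z, min (epos (f z)) k ∂P ≠ ⊤ :=
        ((lintegral_mono fun z => min_le_right _ _).trans_lt (by
          simpa using ENNReal.mul_lt_top (ENNReal.natCast_lt_top k) (measure_lt_top P _))).ne
      refine ⟨_, hpm.min measurable_const, fun z => min_le_left _ _, hfin, ?_⟩
      have := (ENNReal.ofReal_le_iff_le_toReal hfin).1 hk.le
      linarith
    · refine ⟨_, hpm, fun _ => le_rfl, hpos, ?_⟩
      rwa [lowExp, ← EReal.coe_ennreal_toReal hpos, ← EReal.coe_ennreal_toReal hneg,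
        ← EReal.coe_sub, EReal.coe_le_coe_iff] at hb
  have hψlt := ae_lt_top hψm hψtop
  have hneglt := ae_lt_top hnm hneg
  have hψi := integrable_toReal_of_lintegral_ne_top hψm.aemeasurable hψtop
  have hni := integrable_toReal_of_lintegral_ne_top hnm.aemeasurable hneg
  refine ⟨fun z => (ψ z).toReal - (epos (-f z)).toReal, hψi.sub hni, ?_, ?_⟩
  · filter_upwards [hψlt, hneglt] with z h1 h2
    have h3 := hψle z
    generalize f z = e at h2 h3 ⊢
    induction e with
    | bot => simp [epos] at h2
    | top => simp
    | coe x =>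
      rw [← EReal.coe_neg, epos_coe] at *
      rw [EReal.coe_le_coe_iff]
      have h4 := ENNReal.toReal_mono ENNReal.ofReal_ne_top h3
      rw [ENNReal.toReal_ofReal'] at h4 ⊢
      rcases le_total 0 x with h | h
      · rw [max_eq_left h] at h4
        linarith [le_max_right (-x) 0]
      · rw [max_eq_right h] at h4
        linarith [le_max_left (-x) 0]
  · rwa [integral_sub hψi hni, integral_toReal hψm.aemeasurable hψlt,
      integral_toReal hnm.aemeasurable hneglt]

/-- The expected disutility under any distribution in the ambiguity set is bounded by the supremum
of (AD-B'). -/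
theorem le_adbpVal_of_mem_ambSet {dz I J L : ℕ} [NeZero I]
    {gi : Fin I → (Fin dz → ℝ) → EReal}
    {c : Fin L → (Fin dz → ℝ) → EReal} {h : Fin J → (Fin dz → ℝ) → EReal} {μ : Fin J → ℝ}
    (hG : AssumptionG gi) (hC : AssumptionC c) (hH : AssumptionH h)
    (hmg : ∀ i, Measurable (gi i)) (hmh : ∀ j, Measurable (h j))
    {P : Measure (Fin dz → ℝ)} (hP : P ∈ ambSet c h μ) {b : ℝ}
    (hb : (b : EReal) ≤ lowExp P (gFun gi)) : (b : EReal) ≤ adbpVal gi c h μ := by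
  obtain ⟨hprob, hPS, hPh⟩ := hP
  have hSm : MeasurableSet (Sset c) := by
    rw [Sset, Set.ofPred_forall]
    exact MeasurableSet.iInter fun ℓ => ((hC ℓ).2.1.1.measurable measurableSet_Iic)
  have hSae : ∀ᵐ z ∂P, z ∈ Sset c := (mem_ae_iff_prob_eq_one hSm).2 hPS
  obtain ⟨φ, hφi, hφle, hφb⟩ := exists_integrable_le_of_le_lowExp (Measurable.iSup hmg) hb
  have hex : ∀ j, ∃ ψ : (Fin dz → ℝ) → ℝ, Integrable ψ P ∧
      (∀ᵐ z ∂P, (ψ z : EReal) ≤ -h j z) ∧ -μ j ≤ ∫ z, ψ z ∂P := fun j =>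
    exists_integrable_le_of_le_lowExp (hmh j).neg (by
      rw [EReal.coe_neg]
      exact EReal.neg_le.1 (hPh j))
  choose ψ hψi hψle hψb using hex
  let C : Set ((Fin J → ℝ) × ℝ) :=
    {q | ∃ r ∈ adbpFeas gi c h q.1, q.2 ≤ ∑ i, r.1 i}
  have hCconv : Convex ℝ C := by
    rintro q ⟨r, hr, hqr⟩ q' ⟨r', hr', hqr'⟩ s t hs ht hst
    refine ⟨s • r + t • r', adbpFeas_combo hG hC hH hr hr' hs ht hst, ?_⟩
    have := add_le_add (mul_le_mul_of_nonneg_left hqr hs) (mul_le_mul_of_nonneg_left hqr' ht)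
    simpa [Finset.sum_add_distrib, ← Finset.mul_sum] using this
  have hFi : Integrable (fun z => ((fun j => -ψ j z, φ z) : (Fin J → ℝ) × ℝ)) P :=
    (Integrable.of_eval fun j => (hψi j).neg).prodMk hφi
  have hFC : ∀ᵐ z ∂P, ((fun j => -ψ j z, φ z) : (Fin J → ℝ) × ℝ) ∈ C := by
    filter_upwards [hSae, hφle, ae_all_iff.2 hψle] with z hzS hzφ hzψ
    obtain ⟨k, hk⟩ := exists_eq_ciSup_of_finite (f := fun i => gi i z)
    change (φ z : EReal) ≤ ⨆ i, gi i z at hzφ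
    rw [← hk] at hzφ
    refine ⟨(Pi.single k (φ z), Pi.single k 1, Pi.single k fun j => -ψ j z, Pi.single k z), ?_, ?_⟩
    · rw [mem_adbpFeas_iff]
      refine ⟨by simp, fun j => ?_, fun i => ?_, fun i ℓ => ?_, fun i j => ?_, fun i => ?_⟩
      · rw [Finset.sum_eq_single k (fun i _ hi => by simp [Pi.single_eq_of_ne hi]) (by simp)]
        simp
      all_goals by_cases hi : i = k
      · simp [hi]
      · simp [Pi.single_eq_of_ne hi]
      · simpa [hi, persp_one] using hzS ℓ
      · simpa [Pi.single_eq_of_ne hi] using persp_zero_zero_le (c ℓ) le_rfl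
      · simpa [hi, persp_one] using EReal.le_neg_of_le_neg (hzψ j)
      · simpa [Pi.single_eq_of_ne hi] using persp_zero_zero_le (h j) le_rfl
      · simpa [hi, persp_one] using hzφ
      · simpa [Pi.single_eq_of_ne hi] using persp_zero_zero_le (fun z => -gi i z) le_rfl
    · simp
  have hmem := convex_integral_mem_of_finrank P _ _ rfl C hCconv _ hFi hFC
  obtain ⟨r, hr, hle⟩ := hmem
  rw [snd_integral hFi] at hle
  have hr' : r ∈ adbpFeas gi c h μ := by
    rw [mem_adbpFeas_iff] at hr ⊢
    refine ⟨hr.1, fun j => (hr.2.1 j).trans ?_, hr.2.2⟩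
    rw [fst_integral hFi, eval_integral (f := fun z j => -ψ j z) fun j => (hψi j).neg,
      integral_neg]
    linarith [hψb j]
  exact (EReal.coe_le_coe_iff.2 (hφb.trans hle)).trans (le_iSup₂_of_le r hr' le_rfl)

/-- **Approximate numerical solution of (P-UQ)** (Corollary 4.1): under assumptions
(G), (C), (H) and (S), if (AD-B') admits a Slater point with `λ > 0`, then the suprema
of (P-UQ) and (AD-B') coincide, and for every `ε > 0` there is a discrete distribution
`P ∈ 𝒫` supported on at most `I` points with `E_P[g(z̃)] ≥ sup (P-UQ) − 2ε` if
`sup (P-UQ)` is finite and `E_P[g(z̃)] ≥ 1/(2ε)` if `sup (P-UQ) = +∞`. -/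
theorem puq_approximate_solution (dz I J L : ℕ)
    (gi : Fin I → (Fin dz → ℝ) → EReal) (c : Fin L → (Fin dz → ℝ) → EReal)
    (h : Fin J → (Fin dz → ℝ) → EReal) (μ : Fin J → ℝ)
    (hG : AssumptionG gi) (hC : AssumptionC c) (hH : AssumptionH h)
    (hS : AssumptionS gi c h) (hSne : (Sset c).Nonempty)
    (hmg : ∀ i, Measurable (gi i)) (hmh : ∀ j, Measurable (h j))
    (hSlater : ∃ r, SlaterADBP gi c h μ r ∧ ∀ i, 0 < r.2.1 i) :
    puqVal gi c h μ = adbpVal gi c h μ ∧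
    ∀ ε : ℝ, 0 < ε →
      ∃ (lam : Fin I → ℝ) (pts : Fin I → Fin dz → ℝ),
        (∀ i, 0 ≤ lam i) ∧ (∑ i, lam i) = 1 ∧
        (∑ i, ENNReal.ofReal (lam i) • Measure.dirac (pts i)) ∈ ambSet c h μ ∧
        (puqVal gi c h μ ≠ ⊤ →
          puqVal gi c h μ - ((2 * ε : ℝ) : EReal) ≤
            lowExp (∑ i, ENNReal.ofReal (lam i) • Measure.dirac (pts i)) (gFun gi)) ∧
        (puqVal gi c h μ = ⊤ →
          ((1 / (2 * ε) : ℝ) : EReal) ≤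
            lowExp (∑ i, ENNReal.ofReal (lam i) • Measure.dirac (pts i)) (gFun gi)) := by
  obtain ⟨s, ⟨-, -, -, hs, -⟩, hspos⟩ := hSlater
  have hI : NeZero I := ⟨by
    rintro rfl
    simpa using hs.1⟩
  have hdisc := fun b => exists_discrete_of_lt_adbpVal hG hC hH hs hspos (b := b)
  have hval : puqVal gi c h μ = adbpVal gi c h μ := by
    apply le_antisymm
    · refine iSup₂_le fun P hP => EReal.ge_of_forall_gt_iff_ge.1 fun b hb => ?_
      exact le_adbpVal_of_mem_ambSet hG hC hH hmg hmh hP.1 hb.le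
    · refine EReal.ge_of_forall_gt_iff_ge.1 fun b hb => ?_
      obtain ⟨lam, pts, -, -, hmem, hle⟩ := hdisc b hb
      refine hle.trans (le_iSup₂_of_le _ ⟨hmem, fun hbot => ?_⟩ le_rfl)
      rw [hbot, le_bot_iff] at hle
      exact EReal.coe_ne_bot _ hle
  refine ⟨hval, fun ε hε => ?_⟩
  have hbot : adbpVal gi c h μ ≠ ⊥ := by
    intro hbot
    have : ((∑ i, s.1 i : ℝ) : EReal) ≤ adbpVal gi c h μ := le_iSup₂_of_le s hs le_rfl
    rw [hbot, le_bot_iff] at this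
    exact EReal.coe_ne_bot _ this
  rw [hval]
  by_cases htop : adbpVal gi c h μ = ⊤
  · obtain ⟨lam, pts, h1, h2, h3, h4⟩ := hdisc (1 / (2 * ε)) (htop ▸ EReal.coe_lt_top _)
    exact ⟨lam, pts, h1, h2, h3, fun hne => absurd htop hne, fun _ => h4⟩
  · have hlt : (((adbpVal gi c h μ).toReal - 2 * ε : ℝ) : EReal) < adbpVal gi c h μ := by
      conv_rhs => rw [← EReal.coe_toReal htop hbot]
      rw [EReal.coe_lt_coe_iff]
      linarith
    obtain ⟨lam, pts, h1, h2, h3, h4⟩ := hdisc _ hlt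
    rw [EReal.coe_sub, EReal.coe_toReal htop hbot] at h4
    exact ⟨lam, pts, h1, h2, h3, fun _ => h4, fun h => absurd h htop⟩
end
end
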